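/- arXiv:2104.05811 — 2 statements merged into one kernel-verified Lean document; each statement's English description precedes it below -/
import Mathlib

section
/- Let G be a group and A an abelian normal subgroup of G such that G/A is a finitely generated nilpotent group. If G has no proper contranormal subgroups, then G is locally nilpotent. -/
open Subgroup
open scoped commutatorElement

/-- `CentralPolycyclic A K` says that `K` is obtained from `A` by successively adjoining finitely
many elements, each of which is central in `G` modulo the subgroup reached before. -/
inductive CentralPolycyclic {G : Type*} [Group G] (A : Subgroup G) : Subgroup G → Prop
  | base : CentralPolycyclic A A
  | step {K : Subgroup G} (z : G) : CentralPolycyclic A K → (∀ g, ⁅z, g⁆ ∈ K) →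
      CentralPolycyclic A (K ⊔ zpowers z)

namespace CentralPolycyclic

variable {G : Type*} [Group G] {A K : Subgroup G}

theorem normal_sup_zpowers [K.Normal] {z : G} (hz : ∀ g, ⁅z, g⁆ ∈ K) :
    (K ⊔ zpowers z).Normal := by
  rw [← QuotientGroup.ker_mk' K] at hz ⊢
  have hc : ∀ g, QuotientGroup.mk' K z * QuotientGroup.mk' K g
      = QuotientGroup.mk' K g * QuotientGroup.mk' K z := by
    intro g
    have := hz g
    rwa [MonoidHom.mem_ker, map_commutatorElement, commutatorElement_eq_one_iff_mul_comm] at this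
  rw [sup_comm, ← comap_map_eq]
  have : (map (QuotientGroup.mk' K) (zpowers z)).Normal := by
    refine ⟨fun n hn g => ?_⟩
    obtain ⟨g, rfl⟩ := QuotientGroup.mk'_surjective K g
    rw [MonoidHom.map_zpowers] at hn ⊢
    obtain ⟨k, rfl⟩ := mem_zpowers_iff.1 hn
    have h : Commute (QuotientGroup.mk' K g) (QuotientGroup.mk' K z ^ k) :=
      Commute.zpow_right (hc g).symm k
    rwa [h.eq, mul_inv_cancel_right]
  exact this.comap _

theorem normal [A.Normal] (h : CentralPolycyclic A K) : K.Normal := by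
  induction h with
  | base => infer_instance
  | step z _ hz ih => exact normal_sup_zpowers hz

theorem sup_closure (h : CentralPolycyclic A K) {s : Set G} (hs : s.Finite)
    (hc : ∀ z ∈ s, ∀ g, ⁅z, g⁆ ∈ K) : CentralPolycyclic A (K ⊔ closure s) := by
  induction s, hs using Set.Finite.induction_on with
  | empty => simpa using h
  | @insert a s _ _ ih =>
    have h' := ih fun z hz => hc z (Set.mem_insert_of_mem _ hz)
    have := h'.step a fun g => (le_sup_left : K ≤ _) (hc a (Set.mem_insert _ _) g)
    rwa [sup_assoc, sup_comm (closure s), zpowers_eq_closure, ← Subgroup.closure_union,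
      Set.singleton_union] at this

theorem comap {Q : Type*} [Group Q] {f : G →* Q} (hf : Function.Surjective f) {L : Subgroup Q}
    (h : CentralPolycyclic ⊥ L) : CentralPolycyclic f.ker (L.comap f) := by
  induction h with
  | base => exact MonoidHom.comap_bot f ▸ base
  | @step K z _ hz ih =>
    obtain ⟨z, rfl⟩ := hf z
    have := ih.step z fun g => by
      rw [mem_comap, map_commutatorElement]
      exact hz _
    convert this using 1
    rw [← MonoidHom.map_zpowers, ← comap_map_eq_self (f := f) (H := K.comap f ⊔ zpowers z),
      Subgroup.map_sup, map_comap_eq_self_of_surjective hf]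
    exact le_sup_of_le_left (ker_le_comap f K)

end CentralPolycyclic

section IteratedCommutators

variable {G : Type*} [Group G]

/-- The left-normed commutators of weight `n + 1` in elements of `s`. -/
def iteratedCommutators (s : Set G) : ℕ → Set G
  | 0 => s
  | n + 1 => Set.image2 (fun c x => ⁅c, x⁆) (iteratedCommutators s n) s

theorem finite_iteratedCommutators {s : Set G} (hs : s.Finite) (n : ℕ) :
    (iteratedCommutators s n).Finite := by
  induction n with
  | zero => exact hs
  | succ n ih => exact ih.image2 _ hs

theorem iteratedCommutators_subset_lowerCentralSeries (s : Set G) (n : ℕ) :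
    iteratedCommutators s n ⊆ (⊤ : Subgroup G).lowerCentralSeries n := by
  induction n with
  | zero => simp
  | succ n ih =>
    rintro _ ⟨c, hc, x, -, rfl⟩
    exact commutator_mem_commutator (ih hc) (mem_top x)

theorem commutator_normalClosure_le {s c : Set G} (hs : closure s = ⊤) {N : Subgroup G} [N.Normal]
    (h : ∀ a ∈ c, ∀ x ∈ s, ⁅a, x⁆ ∈ N) : ⁅normalClosure c, (⊤ : Subgroup G)⁆ ≤ N := by
  have key : normalClosure c ≤ (center (G ⧸ N)).comap (QuotientGroup.mk' N) := by
    refine normalClosure_le_normal fun a ha => ?_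
    have : (⊤ : Subgroup G) ≤
        (centralizer {QuotientGroup.mk' N a}).comap (QuotientGroup.mk' N) := by
      rw [← hs, closure_le]
      intro x hx
      have := h a ha x hx
      rw [← QuotientGroup.ker_mk' N, MonoidHom.mem_ker, map_commutatorElement,
        commutatorElement_eq_one_iff_mul_comm] at this
      simpa [mem_centralizer_singleton_iff] using this.symm
    simp only [SetLike.mem_coe, mem_comap, mem_center_iff]
    intro g
    obtain ⟨g, rfl⟩ := QuotientGroup.mk'_surjective N g
    have := this (mem_top g)
    rw [mem_comap, mem_centralizer_singleton_iff] at this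
    exact this
  rw [commutator_le]
  intro a ha g _
  have := mem_center_iff.1 (key ha) (QuotientGroup.mk' N g)
  rw [← QuotientGroup.ker_mk' N, MonoidHom.mem_ker, map_commutatorElement,
    commutatorElement_eq_one_iff_mul_comm]
  exact this.symm

theorem lowerCentralSeries_eq_normalClosure {s : Set G} (hs : closure s = ⊤) (n : ℕ) :
    (⊤ : Subgroup G).lowerCentralSeries n = normalClosure (iteratedCommutators s n) := by
  apply le_antisymm
  · induction n with
    | zero =>
      rw [Subgroup.lowerCentralSeries_zero, ← hs]
      exact closure_le_normalClosure
    | succ n ih =>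
      refine (commutator_mono ih le_rfl).trans (commutator_normalClosure_le hs ?_)
      exact fun a ha x hx => subset_normalClosure ⟨a, ha, x, hx, rfl⟩
  · exact normalClosure_le_normal (iteratedCommutators_subset_lowerCentralSeries s n)

theorem Group.FG.exists_finite_lowerCentralSeries_eq_normalClosure (h : Group.FG G) (n : ℕ) :
    ∃ s : Set G, s.Finite ∧ (⊤ : Subgroup G).lowerCentralSeries n = normalClosure s := by
  obtain ⟨s, hs, hfin⟩ := Group.fg_iff.1 h
  exact ⟨_, finite_iteratedCommutators hfin n, lowerCentralSeries_eq_normalClosure hs n⟩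

theorem centralPolycyclic_of_isNilpotent (h : Group.FG G) (hn : Group.IsNilpotent G) :
    CentralPolycyclic (⊥ : Subgroup G) ⊤ := by
  obtain ⟨s, hs, hfin⟩ := Group.fg_iff.1 h
  obtain ⟨c, hc⟩ := Subgroup.nilpotent_iff_lowerCentralSeries.1 hn
  suffices ∀ k ≤ c,
      CentralPolycyclic (⊥ : Subgroup G) ((⊤ : Subgroup G).lowerCentralSeries (c - k)) by
    simpa using this c le_rfl
  intro k
  induction k with
  | zero => intro _; simpa [hc] using CentralPolycyclic.base
  | succ k ih =>
    intro hk
    obtain ⟨n, hn, hn'⟩ : ∃ n, c - (k + 1) = n ∧ c - k = n + 1 := ⟨_, rfl, by omega⟩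
    rw [hn]
    have ih := ih (by omega)
    rw [hn'] at ih
    have hcomm : ∀ z ∈ (⊤ : Subgroup G).lowerCentralSeries n, ∀ g,
        ⁅z, g⁆ ∈ (⊤ : Subgroup G).lowerCentralSeries (n + 1) :=
      fun z hz g => commutator_mem_commutator hz (mem_top g)
    have hsub := iteratedCommutators_subset_lowerCentralSeries s n
    have := ih.sup_closure (finite_iteratedCommutators hfin n) fun z hz => hcomm z (hsub hz)
    have hnorm := this.normal
    convert this using 1
    apply le_antisymm
    · rw [lowerCentralSeries_eq_normalClosure hs n]
      exact normalClosure_le_normal (subset_closure.trans (SetLike.coe_subset_coe.2 le_sup_right))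
    · exact sup_le (Subgroup.lowerCentralSeries_antitone _ n.le_succ) ((closure_le _).2 hsub)

theorem centralPolycyclic_of_quotient (A : Subgroup G) [A.Normal] (h : Group.FG (G ⧸ A))
    (hn : Group.IsNilpotent (G ⧸ A)) : CentralPolycyclic A ⊤ := by
  simpa using (centralPolycyclic_of_isNilpotent h hn).comap (QuotientGroup.mk'_surjective A)

end IteratedCommutators

/-- `N'` is obtained from `N` by adding a free module, up to `f`-power torsion. -/
def IsGenericallyFreeOver {J M : Type*} [CommRing J] [AddCommGroup M] [Module J M] (f : J)
    (N N' : Submodule J M) : Prop :=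
  ∃ b : Set M, b ⊆ N' ∧
    (∀ l ∈ Finsupp.supported J J b, Finsupp.linearCombination J id l ∈ N → l = 0) ∧
    ∀ x ∈ N', ∃ k : ℕ, f ^ k • x ∈ N ⊔ Submodule.span J b

namespace IsGenericallyFreeOver

variable {J M : Type*} [CommRing J] [AddCommGroup M] [Module J M] {f g : J}
  {N N' : Submodule J M}

theorem of_dvd (h : IsGenericallyFreeOver f N N') (hfg : f ∣ g) :
    IsGenericallyFreeOver g N N' := by
  obtain ⟨b, hb, hli, hsp⟩ := h
  obtain ⟨c, rfl⟩ := hfg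
  refine ⟨b, hb, hli, fun x hx => ?_⟩
  obtain ⟨k, hk⟩ := hsp x hx
  refine ⟨k, ?_⟩
  rw [mul_pow, mul_comm, mul_smul]
  exact Submodule.smul_mem _ _ hk

theorem iSup_nat {P : ℕ → Submodule J M} (hP : Monotone P)
    (h : ∀ n, IsGenericallyFreeOver f (P n) (P (n + 1))) :
    IsGenericallyFreeOver f (P 0) (⨆ n, P n) := by
  classical
  choose C hC hli hsp using h
  let B : ℕ → Set M := fun n => ⋃ i ∈ Finset.range n, C i
  have hB : ∀ n, B (n + 1) = B n ∪ C n := fun n => by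
    rw [Set.union_comm]
    exact (congrArg (fun s : Finset ℕ => ⋃ i ∈ s, C i) Finset.range_add_one).trans
      (Finset.set_biUnion_insert _ _ _)
  have hBmono : Monotone B := monotone_nat_of_le_succ fun n => by
    rw [hB]; exact Set.subset_union_left
  have hBP : ∀ n, B n ⊆ P n := fun n => by
    simp only [B, Set.iUnion_subset_iff, Finset.mem_range]
    exact fun i hi => (hC i).trans (SetLike.coe_subset_coe.2 (hP hi))
  have hBli : ∀ n, ∀ l ∈ Finsupp.supported J J (B n),
      Finsupp.linearCombination J id l ∈ P 0 → l = 0 := by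
    intro n
    induction n with
    | zero => intro l hl _; simpa [B] using hl
    | succ n ih =>
      intro l hl hl0
      have hadd := Finsupp.filter_add_filter_not l (· ∈ B n)
      have h1 : l.filter (· ∈ B n) ∈ Finsupp.supported J J (B n) := by
        intro x hx
        rw [Finset.mem_coe, Finsupp.support_filter, Finset.mem_filter] at hx
        exact hx.2
      have h2 : l.filter (fun x => ¬ x ∈ B n) ∈ Finsupp.supported J J (C n) := by
        intro x hx
        rw [Finset.mem_coe, Finsupp.support_filter, Finset.mem_filter] at hx
        have := hl hx.1
        rw [hB] at this
        exact this.resolve_left hx.2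
      have h3 : l.filter (fun x => ¬ x ∈ B n) = 0 := by
        refine hli n _ h2 ?_
        have e : Finsupp.linearCombination J id (l.filter (fun x => ¬ x ∈ B n)) =
            Finsupp.linearCombination J id l -
              Finsupp.linearCombination J id (l.filter (· ∈ B n)) := by
          rw [eq_sub_iff_add_eq', ← map_add, hadd]
        rw [e]
        refine sub_mem (hP (Nat.zero_le n) hl0) ?_
        have : Finsupp.linearCombination J id (l.filter (· ∈ B n)) ∈
            Submodule.span J (id '' B n) :=
          (Finsupp.mem_span_image_iff_linearCombination J).2 ⟨_, h1, rfl⟩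
        rw [Set.image_id] at this
        exact Submodule.span_le.2 (hBP n) this
      rw [h3, add_zero] at hadd
      exact ih l (hadd ▸ h1) hl0
  have hBsp : ∀ n, ∀ x ∈ P n, ∃ k : ℕ, f ^ k • x ∈ P 0 ⊔ Submodule.span J (B n) := by
    intro n
    induction n with
    | zero => exact fun x hx => ⟨0, Submodule.smul_mem _ _ (Submodule.mem_sup_left hx)⟩
    | succ n ih =>
      intro x hx
      obtain ⟨k, hk⟩ := hsp n x hx
      obtain ⟨y, hy, c, hc, hyc⟩ := Submodule.mem_sup.1 hk
      obtain ⟨j, hj⟩ := ih y hy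
      refine ⟨j + k, ?_⟩
      rw [pow_add, mul_smul, ← hyc, smul_add, hB, Submodule.span_union, ← sup_assoc]
      exact add_mem (Submodule.mem_sup_left hj)
        (Submodule.mem_sup_right (Submodule.smul_mem _ _ hc))
  refine ⟨⋃ n, B n, ?_, ?_, ?_⟩
  · exact Set.iUnion_subset fun n => (hBP n).trans (SetLike.coe_subset_coe.2 (le_iSup P n))
  · intro l hl hl0
    obtain ⟨n, hn⟩ := hBmono.directed_le.exists_mem_subset_of_finset_subset_biUnion
      (s := l.support) hl
    exact hBli n l hn hl0
  · intro x hx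
    obtain ⟨n, hn⟩ := (Submodule.mem_iSup_of_directed P hP.directed_le).1 hx
    obtain ⟨k, hk⟩ := hBsp n x hn
    have hle : P 0 ⊔ Submodule.span J (B n) ≤ P 0 ⊔ Submodule.span J (⋃ n, B n) :=
      sup_le_sup_left (Submodule.span_mono (Set.subset_iUnion B n)) _
    exact ⟨k, hle hk⟩

theorem map_sup (e : M →ₗ[J] M) {X Y : Submodule J M}
    (h : IsGenericallyFreeOver f X Y) (hX : X.map e ≤ N) (hY : Y ⊓ N.comap e ≤ X) :
    IsGenericallyFreeOver f N (N ⊔ Y.map e) := by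
  obtain ⟨b, hb, hli, hsp⟩ := h
  refine ⟨e '' b, ?_, ?_, ?_⟩
  · rintro _ ⟨x, hx, rfl⟩
    exact Submodule.mem_sup_right ⟨x, hb hx, rfl⟩
  · intro l hl hlN
    rw [Finsupp.supported_eq_span_single] at hl
    obtain ⟨l', hl', rfl⟩ : ∃ l' ∈ Finsupp.supported J J b, Finsupp.lmapDomain J J e l' = l := by
      rw [← Finsupp.supported_eq_span_single, ← Finsupp.lmapDomain_supported] at hl
      exact hl
    have e1 : Finsupp.linearCombination J id (Finsupp.lmapDomain J J e l') =
        e (Finsupp.linearCombination J id l') := by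
      simp [Finsupp.linearCombination_mapDomain, Finsupp.apply_linearCombination]
    rw [e1] at hlN
    rw [hli l' hl' (hY ⟨?_, hlN⟩), map_zero]
    have := (Finsupp.mem_span_image_iff_linearCombination (v := id) J).2 ⟨_, hl', rfl⟩
    rw [Set.image_id] at this
    exact Submodule.span_le.2 hb this
  · intro x hx
    obtain ⟨n, hn, _, ⟨y, hy, rfl⟩, rfl⟩ := Submodule.mem_sup.1 hx
    obtain ⟨k, hk⟩ := hsp y hy
    refine ⟨k, ?_⟩
    rw [smul_add, ← map_smul]
    refine add_mem (Submodule.mem_sup_left (Submodule.smul_mem _ _ hn)) ?_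
    have := Submodule.mem_map_of_mem (f := e) hk
    rw [Submodule.map_sup, Submodule.map_span] at this
    exact sup_le_sup_right hX _ this

theorem refl (f : J) (N : Submodule J M) : IsGenericallyFreeOver f N N :=
  ⟨∅, Set.empty_subset _, fun l hl _ => by simpa using hl,
    fun _ hx => ⟨0, Submodule.smul_mem _ _ (Submodule.mem_sup_left hx)⟩⟩

theorem trans {N'' : Submodule J M} (hN : N ≤ N') (hN' : N' ≤ N'')
    (h : IsGenericallyFreeOver f N N') (h' : IsGenericallyFreeOver f N' N'') :
    IsGenericallyFreeOver f N N'' := by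
  let P : ℕ → Submodule J M
    | 0 => N
    | 1 => N'
    | _ + 2 => N''
  have hP : Monotone P := monotone_nat_of_le_succ fun
    | 0 => hN
    | 1 => hN'
    | _ + 2 => le_rfl
  have hs : ⨆ n, P n = N'' :=
    le_antisymm (iSup_le fun
      | 0 => hN.trans hN'
      | 1 => hN'
      | _ + 2 => le_rfl) (le_iSup P 2)
  rw [← hs]
  exact iSup_nat hP fun
    | 0 => h
    | 1 => h'
    | _ + 2 => refl _ _

theorem exists_of_singleton [IsDomain J] (N : Submodule J M) (a : M) :
    ∃ f : J, f ≠ 0 ∧ IsGenericallyFreeOver f N (N ⊔ Submodule.span J {a}) := by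
  by_cases h : ∃ c : J, c ≠ 0 ∧ c • a ∈ N
  · obtain ⟨c, hc, hca⟩ := h
    refine ⟨c, hc, ∅, Set.empty_subset _, fun l hl _ => by simpa using hl, fun x hx => ⟨1, ?_⟩⟩
    obtain ⟨n, hn, y, hy, rfl⟩ := Submodule.mem_sup.1 hx
    obtain ⟨r, rfl⟩ := Submodule.mem_span_singleton.1 hy
    rw [pow_one, smul_add, smul_comm]
    exact Submodule.mem_sup_left (add_mem (N.smul_mem _ hn) (N.smul_mem _ hca))
  · push Not at h
    refine ⟨1, one_ne_zero, {a}, ?_, fun l hl hlN => ?_, fun x hx => ⟨0, by simpa using hx⟩⟩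
    · rw [Set.singleton_subset_iff]
      exact Submodule.mem_sup_right (Submodule.mem_span_singleton_self a)
    · obtain ⟨c, rfl⟩ : ∃ c, l = Finsupp.single a c :=
        ⟨l a, Finsupp.support_subset_singleton.1 (Finset.coe_subset.1 (by
          rw [Finset.coe_singleton]; exact hl))⟩
      rw [Finsupp.linearCombination_single] at hlN
      have hc : c = 0 := by
        by_contra hc
        exact h c hc hlN
      rw [hc, Finsupp.single_zero]

theorem exists_of_finite [IsDomain J] (N : Submodule J M) {F : Set M} (hF : F.Finite) :
    ∃ f : J, f ≠ 0 ∧ IsGenericallyFreeOver f N (N ⊔ Submodule.span J F) := by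
  induction F, hF using Set.Finite.induction_on with
  | empty => exact ⟨1, one_ne_zero, by simpa using refl 1 N⟩
  | @insert a s _ _ ih =>
    obtain ⟨f, hf, h⟩ := ih
    obtain ⟨g, hg, h'⟩ := exists_of_singleton (N ⊔ Submodule.span J s) a
    refine ⟨f * g, mul_ne_zero hf hg, ?_⟩
    rw [← Set.union_singleton, Submodule.span_union, ← sup_assoc]
    exact (h.of_dvd (dvd_mul_right f g)).trans le_sup_left le_sup_left
      (h'.of_dvd (dvd_mul_left g f))

/-- If `M` is free up to `f`-power torsion and the fibre of `M` at a prime not containing `f`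
vanishes, then `M` is `f`-power torsion. -/
theorem exists_pow_smul_eq_zero (h : IsGenericallyFreeOver f (⊥ : Submodule J M) ⊤)
    {m : Ideal J} [m.IsPrime] (hf : f ∉ m) (hm : (⊤ : Submodule J M) ≤ m • ⊤) (x : M) :
    ∃ k : ℕ, f ^ k • x = 0 := by
  classical
  obtain ⟨b, -, hli, hsp⟩ := h
  obtain rfl | ⟨y, hy⟩ := b.eq_empty_or_nonempty
  · simpa using hsp x Submodule.mem_top
  exfalso
  have key : ∀ z ∈ m • (⊤ : Submodule J M), ∃ k : ℕ, f ^ k • z ∈ m • Submodule.span J b := by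
    intro z hz
    induction hz using Submodule.smul_induction_on' with
    | smul a ha n _ =>
      obtain ⟨k, hk⟩ := hsp n Submodule.mem_top
      rw [bot_sup_eq] at hk
      refine ⟨k, ?_⟩
      rw [smul_comm]
      exact Submodule.smul_mem_smul ha hk
    | add z₁ _ z₂ _ h₁ h₂ =>
      obtain ⟨k₁, h₁⟩ := h₁
      obtain ⟨k₂, h₂⟩ := h₂
      refine ⟨k₁ + k₂, ?_⟩
      rw [smul_add]
      refine add_mem ?_ ?_
      · rw [pow_add, mul_comm, mul_smul]
        exact Submodule.smul_mem _ _ h₁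
      · rw [pow_add, mul_smul]
        exact Submodule.smul_mem _ _ h₂
  obtain ⟨k, hk⟩ := key y (hm Submodule.mem_top)
  rw [← Set.image_id b, Submodule.mem_ideal_smul_span_iff_exists_sum'] at hk
  obtain ⟨a, ha, hsum⟩ := hk
  have hinj : Function.Injective ((↑) : b → M) := Subtype.val_injective
  have hl : Finsupp.single y (f ^ k) - a.mapDomain (↑) = 0 := by
    refine hli _ (sub_mem (Finsupp.single_mem_supported J _ hy) fun z hz => ?_) ?_
    · obtain ⟨w, -, rfl⟩ := Finset.mem_image.1 (Finsupp.mapDomain_support hz)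
      exact w.2
    · rw [Submodule.mem_bot, map_sub, Finsupp.linearCombination_single,
        Finsupp.linearCombination_mapDomain, Finsupp.linearCombination_apply, sub_eq_zero]
      exact hsum.symm
  have hy' := DFunLike.congr_fun hl y
  rw [Finsupp.sub_apply, Finsupp.single_eq_same, Finsupp.zero_apply, sub_eq_zero,
    show y = ((⟨y, hy⟩ : b) : M) from rfl, Finsupp.mapDomain_apply hinj] at hy'
  exact hf (Ideal.IsPrime.mem_of_pow_mem ‹_› k (hy' ▸ ha _))

end IsGenericallyFreeOver

namespace Representation

variable {J G M : Type*} [CommRing J] [Group G] [AddCommGroup M] [Module J M]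
  (ρ : Representation J G M)

theorem apply_inv_apply (g : G) (x : M) : ρ g (ρ g⁻¹ x) = x := by
  rw [← Module.End.mul_apply, ← map_mul, mul_inv_cancel, map_one, Module.End.one_apply]

theorem apply_mul_apply (g h : G) (x : M) : ρ (g * h) x = ρ g (ρ h x) := by
  rw [map_mul, Module.End.mul_apply]

/-- The subgroup of elements under which a submodule is stable. -/
def submoduleStabilizer (N : Submodule J M) : Subgroup G where
  carrier := {g | ∀ x, ρ g x ∈ N ↔ x ∈ N}
  one_mem' x := by simp
  mul_mem' {g h} hg hh x := by rw [apply_mul_apply, hg, hh]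
  inv_mem' {g} hg x := by rw [← hg, apply_inv_apply]

variable {ρ} {K : Subgroup G} {N : Submodule J M} {F : Set M} {z : G}

theorem mem_submoduleStabilizer {g : G} :
    g ∈ ρ.submoduleStabilizer N ↔ ∀ x, ρ g x ∈ N ↔ x ∈ N := Iff.rfl

theorem le_submoduleStabilizer (h : ∀ k ∈ K, ∀ x ∈ N, ρ k x ∈ N) :
    K ≤ ρ.submoduleStabilizer N := by
  refine fun k hk x => ⟨fun hx => ?_, h k hk x⟩
  have := h k⁻¹ (inv_mem hk) _ hx
  rwa [← apply_mul_apply, inv_mul_cancel, map_one, Module.End.one_apply] at this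

theorem submoduleStabilizer_comap [K.Normal] (hN : K ≤ ρ.submoduleStabilizer N) (g : G) :
    K ≤ ρ.submoduleStabilizer (N.comap (ρ g)) := by
  intro k hk x
  have hk' : g * k * g⁻¹ ∈ K := Subgroup.Normal.conj_mem ‹_› k hk g
  rw [Submodule.mem_comap, Submodule.mem_comap, ← hN hk' (ρ g x), ← apply_mul_apply,
    ← apply_mul_apply, inv_mul_cancel_right]

theorem map_eq_comap_inv (g : G) : N.map (ρ g) = N.comap (ρ g⁻¹) := by
  ext x
  constructor
  · rintro ⟨y, hy, rfl⟩
    rwa [Submodule.mem_comap, ← apply_mul_apply, inv_mul_cancel, map_one]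
  · exact fun hx => ⟨_, hx, apply_inv_apply ρ g x⟩

theorem submoduleStabilizer_inf {N' : Submodule J M} (hN : K ≤ ρ.submoduleStabilizer N)
    (hN' : K ≤ ρ.submoduleStabilizer N') : K ≤ ρ.submoduleStabilizer (N ⊓ N') :=
  fun _ hk x => and_congr (hN hk x) (hN' hk x)

theorem submoduleStabilizer_iSup {ι : Sort*} {P : ι → Submodule J M}
    (hP : ∀ i, K ≤ ρ.submoduleStabilizer (P i)) : K ≤ ρ.submoduleStabilizer (⨆ i, P i) := by
  refine le_submoduleStabilizer fun k hk => ?_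
  change (⨆ i, P i) ≤ (⨆ i, P i).comap (ρ k)
  exact iSup_le fun i x hx => Submodule.mem_iSup_of_mem i ((hP i hk x).2 hx)

theorem submoduleStabilizer_sup {N' : Submodule J M} (hN : K ≤ ρ.submoduleStabilizer N)
    (hN' : K ≤ ρ.submoduleStabilizer N') : K ≤ ρ.submoduleStabilizer (N ⊔ N') := by
  rw [sup_eq_iSup]
  exact submoduleStabilizer_iSup (Bool.forall_bool.2 ⟨hN', hN⟩)

variable (ρ K F) in
/-- The `K`-stable submodule generated by a set. -/
def stableSpan : Submodule J M := Submodule.span J {y | ∃ k ∈ K, ∃ x ∈ F, ρ k x = y}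

theorem submoduleStabilizer_stableSpan : K ≤ ρ.submoduleStabilizer (ρ.stableSpan K F) := by
  refine le_submoduleStabilizer fun k hk => ?_
  change ρ.stableSpan K F ≤ (ρ.stableSpan K F).comap (ρ k)
  refine Submodule.span_le.2 ?_
  rintro _ ⟨l, hl, x, hx, rfl⟩
  exact Submodule.subset_span ⟨k * l, mul_mem hk hl, x, hx, apply_mul_apply ρ k l x⟩

theorem subset_stableSpan : F ⊆ ρ.stableSpan K F :=
  fun x hx => Submodule.subset_span ⟨1, one_mem _, x, hx, by simp⟩

theorem stableSpan_le (hN : K ≤ ρ.submoduleStabilizer N) (hF : F ⊆ N) :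
    ρ.stableSpan K F ≤ N := by
  refine Submodule.span_le.2 ?_
  rintro _ ⟨k, hk, x, hx, rfl⟩
  exact (hN hk x).2 (hF hx)

theorem stableSpan_mono {K' : Subgroup G} (h : K ≤ K') :
    ρ.stableSpan K F ≤ ρ.stableSpan K' F :=
  stableSpan_le (h.trans submoduleStabilizer_stableSpan) subset_stableSpan

variable (ρ K F z) in
/-- The submodule `N + ∑ i < n, zⁱ U`, where `U` is the `K`-stable span of `F`. -/
def layer (N : Submodule J M) : ℕ → Submodule J M
  | 0 => N
  | n + 1 => layer N n ⊔ (ρ.stableSpan K F).map (ρ (z ^ n))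

theorem layer_monotone : Monotone (ρ.layer K F z N) :=
  monotone_nat_of_le_succ fun _ => le_sup_left

theorem layer_mono_left {N' : Submodule J M} (h : N ≤ N') (n : ℕ) :
    ρ.layer K F z N n ≤ ρ.layer K F z N' n := by
  induction n with
  | zero => exact h
  | succ n ih => exact sup_le_sup_right ih _

theorem submoduleStabilizer_layer [K.Normal] (hN : K ≤ ρ.submoduleStabilizer N) (n : ℕ) :
    K ≤ ρ.submoduleStabilizer (ρ.layer K F z N n) := by
  induction n with
  | zero => exact hN
  | succ n ih =>
    refine submoduleStabilizer_sup ih ?_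
    rw [map_eq_comap_inv]
    exact submoduleStabilizer_comap submoduleStabilizer_stableSpan _

theorem layer_le_comap (hz : z ∈ ρ.submoduleStabilizer N) (n : ℕ) :
    ρ.layer K F z N n ≤ (ρ.layer K F z N (n + 1)).comap (ρ z) := by
  induction n with
  | zero => exact fun x hx => Submodule.mem_sup_left ((hz x).2 hx)
  | succ n ih =>
    refine sup_le (ih.trans (Submodule.comap_mono (layer_monotone (Nat.le_succ _)))) ?_
    rintro _ ⟨x, hx, rfl⟩
    refine Submodule.mem_sup_right ⟨x, hx, ?_⟩
    rw [← apply_mul_apply, ← pow_succ']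

variable (ρ K F z) in
/-- The elements `x` of the `K`-stable span of `F` for which `zⁿ x` lies in the `n`-th layer. -/
def leading (N : Submodule J M) (n : ℕ) : Submodule J M :=
  ρ.stableSpan K F ⊓ (ρ.layer K F z N n).comap (ρ (z ^ n))

theorem submoduleStabilizer_leading [K.Normal] (hN : K ≤ ρ.submoduleStabilizer N) (n : ℕ) :
    K ≤ ρ.submoduleStabilizer (ρ.leading K F z N n) :=
  submoduleStabilizer_inf submoduleStabilizer_stableSpan
    (submoduleStabilizer_comap (submoduleStabilizer_layer hN n) _)

theorem leading_monotone (hz : z ∈ ρ.submoduleStabilizer N) :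
    Monotone (ρ.leading K F z N) := by
  refine monotone_nat_of_le_succ fun n => inf_le_inf_left _ fun x hx => ?_
  rw [Submodule.mem_comap, pow_succ', apply_mul_apply]
  exact layer_le_comap hz n hx

theorem leading_mono_left {N' : Submodule J M} (h : N ≤ N') (n : ℕ) :
    ρ.leading K F z N n ≤ ρ.leading K F z N' n :=
  inf_le_inf_left _ (Submodule.comap_mono (layer_mono_left h n))

theorem layer_inf_le {N' : Submodule J M} (h : N ≤ N')
    (hX : ∀ n, ρ.leading K F z N' n ≤ ρ.leading K F z N n) (n : ℕ) :
    ρ.layer K F z N n ⊓ N' ≤ N := by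
  induction n with
  | zero => exact inf_le_left
  | succ n ih =>
    rintro x ⟨hx, hx'⟩
    obtain ⟨w, hw, _, ⟨m, hm, rfl⟩, rfl⟩ := Submodule.mem_sup.1 hx
    have hm' : m ∈ ρ.leading K F z N' n := by
      refine ⟨hm, ?_⟩
      have := sub_mem (layer_monotone (Nat.zero_le n) hx' : _ ∈ ρ.layer K F z N' n)
        (layer_mono_left h n hw)
      rwa [add_sub_cancel_left] at this
    exact ih ⟨add_mem hw (hX n hm').2, hx'⟩

variable (ρ K F z) in
/-- The submodules `z⁻ᵏ (N + ∑ i, zⁱ U)`, where `U` is the `K`-stable span of `F`. -/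
def shifted (N : Submodule J M) (k : ℕ) : Submodule J M :=
  (⨆ n, ρ.layer K F z N n).comap (ρ (z ^ k))

theorem iSup_layer_le_comap (hz : z ∈ ρ.submoduleStabilizer N) :
    (⨆ n, ρ.layer K F z N n) ≤ (⨆ n, ρ.layer K F z N n).comap (ρ z) :=
  iSup_le fun n => (layer_le_comap hz n).trans (Submodule.comap_mono (le_iSup _ _))

theorem shifted_monotone (hz : z ∈ ρ.submoduleStabilizer N) : Monotone (ρ.shifted K F z N) := by
  refine monotone_nat_of_le_succ fun n x hx => ?_
  rw [shifted, Submodule.mem_comap, pow_succ', apply_mul_apply]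
  exact iSup_layer_le_comap hz hx

theorem iSup_shifted [K.Normal] (hN : K ⊔ Subgroup.zpowers z ≤ ρ.submoduleStabilizer N) :
    ⨆ k, ρ.shifted K F z N k = N ⊔ ρ.stableSpan (K ⊔ Subgroup.zpowers z) F := by
  have hz : z ∈ ρ.submoduleStabilizer N :=
    hN (Subgroup.mem_sup_right (Subgroup.mem_zpowers z))
  have hstab : K ⊔ Subgroup.zpowers z ≤
      ρ.submoduleStabilizer (N ⊔ ρ.stableSpan (K ⊔ Subgroup.zpowers z) F) :=
    submoduleStabilizer_sup hN submoduleStabilizer_stableSpan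
  have hzpow : ∀ n : ℕ, z ^ n ∈ K ⊔ Subgroup.zpowers z := fun n =>
    pow_mem (Subgroup.mem_sup_right (Subgroup.mem_zpowers z)) n
  have hdir := (shifted_monotone (K := K) (F := F) hz).directed_le
  have hle : ρ.layer K F z N 1 ≤ ⨆ k, ρ.shifted K F z N k :=
    le_iSup_of_le 0 fun x hx => by
      rw [shifted, pow_zero, map_one]
      exact Submodule.mem_iSup_of_mem 1 hx
  apply le_antisymm
  · refine iSup_le fun k x hx => (hstab (hzpow k) x).1 ?_
    suffices ∀ n, ρ.layer K F z N n ≤ N ⊔ ρ.stableSpan (K ⊔ Subgroup.zpowers z) F from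
      iSup_le this hx
    intro n
    induction n with
    | zero => exact le_sup_left
    | succ n ih =>
      refine sup_le ih (Submodule.map_le_iff_le_comap.2 fun y hy => ?_)
      exact (hstab (hzpow n) y).2 (Submodule.mem_sup_right (stableSpan_mono le_sup_left hy))
  · refine sup_le (le_trans le_sup_left hle) (stableSpan_le (sup_le ?_ ?_) ?_)
    · exact submoduleStabilizer_iSup fun k => submoduleStabilizer_comap
        (submoduleStabilizer_iSup fun n => submoduleStabilizer_layer (le_sup_left.trans hN) n) _
    · rw [Subgroup.zpowers_le, mem_submoduleStabilizer]
      intro x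
      rw [Submodule.mem_iSup_of_directed _ hdir, Submodule.mem_iSup_of_directed _ hdir]
      constructor
      · rintro ⟨k, hk⟩
        refine ⟨k + 1, ?_⟩
        rwa [shifted, Submodule.mem_comap, pow_succ, apply_mul_apply]
      · rintro ⟨k, hk⟩
        refine ⟨k, ?_⟩
        have := shifted_monotone hz (Nat.le_succ k) hk
        rwa [shifted, Submodule.mem_comap, Nat.succ_eq_add_one, pow_succ, apply_mul_apply] at this
    · intro x hx
      refine hle (Submodule.mem_sup_right ⟨x, subset_stableSpan hx, ?_⟩)
      simp

variable (ρ K) in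
/-- The ascending chain condition for `K`-stable submodules of finitely generated ones. -/
def StableACC : Prop :=
  ∀ F : Set M, F.Finite → ∀ N : ℕ → Submodule J M, Monotone N →
    (∀ i, K ≤ ρ.submoduleStabilizer (N i)) → (∀ i, N i ≤ ρ.stableSpan K F) →
    ∃ n, ∀ m, n ≤ m → N m ≤ N n

theorem StableACC.sup_zpowers [K.Normal] (h : ρ.StableACC K) (z : G) :
    ρ.StableACC (K ⊔ Subgroup.zpowers z) := by
  intro F hF N hmono hstab hle
  have hK : ∀ i, K ≤ ρ.submoduleStabilizer (N i) := fun i => le_sup_left.trans (hstab i)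
  have hz : ∀ i, z ∈ ρ.submoduleStabilizer (N i) := fun i =>
    hstab i (Subgroup.mem_sup_right (Subgroup.mem_zpowers z))
  let X : ℕ → ℕ → Submodule J M := fun i n => ρ.leading K F z (N i) n
  have hX : ∀ {i j n m}, i ≤ j → n ≤ m → X i n ≤ X j m := fun hij hnm =>
    (leading_mono_left (hmono hij) _).trans (leading_monotone (hz _) hnm)
  obtain ⟨d, hd⟩ := h F hF (fun k => X k k) (fun a b hab => hX hab hab)
    (fun i => submoduleStabilizer_leading (hK i) i) fun i => inf_le_left
  have hcol : ∀ n, ∃ s, ∀ m, s ≤ m → X m n ≤ X s n := fun n =>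
    h F hF (fun k => X k n) (fun a b hab => hX hab le_rfl)
      (fun i => submoduleStabilizer_leading (hK i) n) fun i => inf_le_left
  choose s hs using hcol
  refine ⟨d + ∑ n ∈ Finset.range d, s n, fun m hm => ?_⟩
  set t := d + ∑ n ∈ Finset.range d, s n with ht
  have hXX : ∀ n, X m n ≤ X t n := by
    intro n
    by_cases hn : n < d
    · have hst : s n ≤ t := le_trans
        (Finset.single_le_sum (f := s) (fun _ _ => Nat.zero_le _) (Finset.mem_range.2 hn))
        (Nat.le_add_left _ _)
      exact (hs n m (hst.trans hm)).trans (hX hst le_rfl)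
    · have hdt : d ≤ t := Nat.le_add_right _ _
      calc X m n ≤ X (max m n) (max m n) := hX (le_max_left _ _) (le_max_right _ _)
        _ ≤ X d d := hd _ (hdt.trans (hm.trans (le_max_left _ _)))
        _ ≤ X t n := hX hdt (not_lt.1 hn)
  intro x hx
  have hx' : x ∈ ⨆ k, ρ.shifted K F z (N t) k := by
    rw [iSup_shifted (hstab t)]
    exact Submodule.mem_sup_right (hle m hx)
  rw [Submodule.mem_iSup_of_directed _ (shifted_monotone (hz t)).directed_le] at hx'
  obtain ⟨k, hk⟩ := hx'
  obtain ⟨n, hn⟩ := (Submodule.mem_iSup_of_directed _ layer_monotone.directed_le).1 hk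
  rw [← pow_mem (hz t) k x]
  exact layer_inf_le (hmono hm) hXX n ⟨hn, (pow_mem (hz m) k x).2 hx⟩

variable (ρ K) in
/-- Finitely generated extensions of `K`-stable submodules are generically free. -/
def StableGenericFreeness : Prop :=
  ∀ N : Submodule J M, K ≤ ρ.submoduleStabilizer N → ∀ F : Set M, F.Finite →
    ∃ f : J, f ≠ 0 ∧ IsGenericallyFreeOver f N (N ⊔ ρ.stableSpan K F)

theorem StableGenericFreeness.sup_zpowers [IsDomain J] [K.Normal] (hacc : ρ.StableACC K)
    (h : ρ.StableGenericFreeness K) (z : G) :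
    ρ.StableGenericFreeness (K ⊔ Subgroup.zpowers z) := by
  intro N hstab F hF
  have hK : K ≤ ρ.submoduleStabilizer N := le_sup_left.trans hstab
  have hz : z ∈ ρ.submoduleStabilizer N :=
    hstab (Subgroup.mem_sup_right (Subgroup.mem_zpowers z))
  have hXK := fun n => submoduleStabilizer_leading (F := F) (z := z) hK n
  obtain ⟨d, hd⟩ := hacc F hF (ρ.leading K F z N) (leading_monotone hz) hXK
    fun i => inf_le_left
  choose c hc hfree using fun n => h (ρ.leading K F z N n) (hXK n) F hF
  set T := ⨆ n, ρ.layer K F z N n with hT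
  have hTK : K ≤ ρ.submoduleStabilizer T :=
    submoduleStabilizer_iSup fun n => submoduleStabilizer_layer hK n
  obtain ⟨e, he, hfree'⟩ := h (T.map (ρ z))
    (by rw [map_eq_comap_inv]; exact submoduleStabilizer_comap hTK _) F hF
  refine ⟨(∏ n ∈ Finset.range (d + 1), c n) * e,
    mul_ne_zero (Finset.prod_ne_zero_iff.2 fun n _ => hc n) he, ?_⟩
  set f := (∏ n ∈ Finset.range (d + 1), c n) * e with hf
  have hlead : ∀ n, IsGenericallyFreeOver f (ρ.leading K F z N n) (ρ.stableSpan K F) := by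
    intro n
    have hle : ∀ n, ρ.leading K F z N n ⊔ ρ.stableSpan K F = ρ.stableSpan K F :=
      fun n => sup_eq_right.2 inf_le_left
    obtain ⟨i, hi, hin⟩ : ∃ i ≤ d, ρ.leading K F z N n = ρ.leading K F z N i := by
      by_cases hn : n ≤ d
      · exact ⟨n, hn, rfl⟩
      · exact ⟨d, le_rfl, (hd n (not_le.1 hn).le).antisymm (leading_monotone hz (not_le.1 hn).le)⟩
    have := hfree i
    rw [hle] at this
    rw [hin]
    exact this.of_dvd (dvd_mul_of_dvd_left
      (Finset.dvd_prod_of_mem c (Finset.mem_range.2 (Nat.lt_succ_of_le hi))) e)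
  have hlayer : IsGenericallyFreeOver f N T :=
    IsGenericallyFreeOver.iSup_nat layer_monotone fun n =>
      (hlead n).map_sup (ρ (z ^ n)) (Submodule.map_le_iff_le_comap.2 inf_le_right) le_rfl
  have hzT : T.map (ρ z) ≤ T := Submodule.map_le_iff_le_comap.2 (iSup_layer_le_comap hz)
  have hTtop : T.map (ρ z) ⊔ ρ.stableSpan K F = T := by
    refine le_antisymm (sup_le hzT ?_) (iSup_le fun n => ?_)
    · refine le_trans ?_ (le_iSup (ρ.layer K F z N) 1)
      exact fun x hx => Submodule.mem_sup_right ⟨x, hx, by simp⟩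
    · induction n with
      | zero =>
        refine fun x hx => Submodule.mem_sup_left ⟨ρ z⁻¹ x, ?_, apply_inv_apply ρ z x⟩
        exact Submodule.mem_iSup_of_mem 0 ((inv_mem hz x).2 hx)
      | succ n ih =>
        refine sup_le ih ?_
        rintro _ ⟨x, hx, rfl⟩
        cases n with
        | zero => simpa using Submodule.mem_sup_right hx
        | succ n =>
          rw [pow_succ', apply_mul_apply]
          exact Submodule.mem_sup_left ⟨_, Submodule.mem_iSup_of_mem (n + 1)
            (Submodule.mem_sup_right ⟨x, hx, rfl⟩), rfl⟩
  rw [hTtop] at hfree'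
  have hshift : ∀ k, IsGenericallyFreeOver f (ρ.shifted K F z N k)
      (ρ.shifted K F z N (k + 1)) := by
    intro k
    have hpow : ∀ x, ρ (z ^ k) (ρ (z ^ (k + 1))⁻¹ x) = ρ z⁻¹ x := fun x => by
      rw [← apply_mul_apply]
      congr 2
      group
    have heq : ρ.shifted K F z N k ⊔ T.map (ρ (z ^ (k + 1))⁻¹) = ρ.shifted K F z N (k + 1) := by
      rw [map_eq_comap_inv, inv_inv]
      exact sup_eq_right.2 (shifted_monotone hz (Nat.le_succ k))
    rw [← heq]
    refine (hfree'.of_dvd (dvd_mul_left e _)).map_sup _ ?_ ?_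
    · rintro _ ⟨_, ⟨x, hx, rfl⟩, rfl⟩
      rw [shifted, Submodule.mem_comap, hpow, ← apply_mul_apply, inv_mul_cancel, map_one]
      exact hx
    · rintro x ⟨-, hx⟩
      rw [SetLike.mem_coe, Submodule.mem_comap, shifted, Submodule.mem_comap, hpow] at hx
      exact ⟨_, hx, apply_inv_apply ρ z x⟩
  rw [← iSup_shifted hstab]
  refine hlayer.trans (le_iSup (ρ.layer K F z N) 0) ?_ ?_
  · refine le_iSup_of_le 0 fun x hx => ?_
    rw [shifted, pow_zero, map_one]
    exact hx
  · have := IsGenericallyFreeOver.iSup_nat (shifted_monotone hz) hshift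
    rwa [shifted, pow_zero, map_one, Module.End.one_eq_id, Submodule.comap_id] at this

theorem stableSpan_eq_span (h : ∀ k ∈ K, ∀ x, ρ k x = x) :
    ρ.stableSpan K F = Submodule.span J F := by
  refine congrArg (Submodule.span J)
    (Set.ext fun y => ⟨?_, fun hy => ⟨1, one_mem _, y, hy, by simp⟩⟩)
  rintro ⟨k, hk, x, hx, rfl⟩
  rwa [h k hk]

theorem stableACC_of_forall_apply_eq [IsNoetherianRing J] (h : ∀ k ∈ K, ∀ x, ρ k x = x) :
    ρ.StableACC K := by
  intro F hF N hmono _ hle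
  rw [stableSpan_eq_span h] at hle
  have : IsNoetherian J (Submodule.span J F) := isNoetherian_span_of_finite J hF
  obtain ⟨n, hn⟩ := monotone_stabilizes_iff_noetherian.2 this
    ⟨fun i => (N i).submoduleOf (Submodule.span J F),
      fun i j hij => Submodule.comap_mono (hmono hij)⟩
  refine ⟨n, fun m hm x hx => ?_⟩
  have hx' : (⟨x, hle m hx⟩ : Submodule.span J F) ∈ (N m).submoduleOf (Submodule.span J F) := hx
  have e : (N n).submoduleOf (Submodule.span J F) = (N m).submoduleOf (Submodule.span J F) :=
    hn m hm
  rw [← e] at hx'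
  exact hx'

variable {A : Subgroup G} [A.Normal]

theorem stableACC_of_centralPolycyclic [IsNoetherianRing J] (h : ∀ k ∈ A, ∀ x, ρ k x = x)
    (hK : CentralPolycyclic A K) : ρ.StableACC K := by
  induction hK with
  | base => exact stableACC_of_forall_apply_eq h
  | step z hK _ ih =>
    have := hK.normal
    exact ih.sup_zpowers z

theorem stableGenericFreeness_of_centralPolycyclic [IsNoetherianRing J] [IsDomain J]
    (h : ∀ k ∈ A, ∀ x, ρ k x = x) (hK : CentralPolycyclic A K) :
    ρ.StableGenericFreeness K := by
  induction hK with
  | base =>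
    intro N _ F hF
    rw [stableSpan_eq_span h]
    exact IsGenericallyFreeOver.exists_of_finite N hF
  | step z hK _ ih =>
    have := hK.normal
    exact ih.sup_zpowers (stableACC_of_centralPolycyclic h hK) z

end Representation

theorem Int.isJacobsonRing : IsJacobsonRing ℤ := by
  rw [isJacobsonRing_iff_prime_eq]
  intro P hP
  by_cases h : P = ⊥
  · subst h
    refine le_antisymm (fun n hn => ?_) Ideal.le_jacobson
    by_contra h0
    rw [Ideal.mem_bot] at h0
    obtain ⟨p, hnp, hp⟩ := Nat.exists_infinite_primes (n.natAbs + 1)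
    have hmax : (Ideal.span {(p : ℤ)}).IsMaximal :=
      PrincipalIdealRing.isMaximal_of_irreducible (Nat.prime_iff_prime_int.1 hp).irreducible
    have := (Ideal.mem_sInf.1 hn) ⟨bot_le, hmax⟩
    rw [Ideal.mem_span_singleton] at this
    have := Int.natAbs_dvd_natAbs.2 this
    rw [Int.natAbs_natCast] at this
    have := Nat.le_of_dvd (Int.natAbs_pos.2 h0) this
    omega
  · have := hP.isMaximal h
    exact Ideal.jacobson_eq_self_of_isMaximal

namespace MonoidAlgebra

open scoped MonoidAlgebra

variable {G M : Type*} [Group G] [AddCommGroup M] [Module ℤ[G] M] {A : Subgroup G}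

variable (M) in
/-- The group representation underlying a module over the integral group ring, over any ring whose
action commutes with it. -/
noncomputable def moduleRepresentation (J : Type*) [CommRing J] [Module J M]
    [SMulCommClass ℤ[G] J M] : Representation J G M :=
  (Module.toModuleEnd J (S := ℤ[G]) M).toMonoidHom.comp (of ℤ G)

theorem smul_mem_of_forall_of_smul_mem (N : AddSubgroup M)
    (h : ∀ g : G, ∀ x ∈ N, of ℤ G g • x ∈ N) (r : ℤ[G]) {x : M} (hx : x ∈ N) : r • x ∈ N := by
  induction r using MonoidAlgebra.induction_on with
  | of g => exact h g x hx
  | add a b ha hb => rw [add_smul]; exact add_mem ha hb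
  | smul n a ha => rw [smul_assoc]; exact zsmul_mem ha n

section

variable {J : Type*} [CommRing J] [Module J M] [SMulCommClass ℤ[G] J M]

theorem stableSpan_moduleRepresentation_eq_top {F : Set M}
    (hF : Submodule.span ℤ[G] F = ⊤) :
    (moduleRepresentation (G := G) M J).stableSpan ⊤ F = ⊤ := by
  refine eq_top_iff.2 fun x _ => ?_
  have hx : x ∈ Submodule.span ℤ[G] F := hF ▸ Submodule.mem_top
  induction hx using Submodule.span_induction with
  | mem x hx => exact Representation.subset_stableSpan hx
  | zero => exact zero_mem _
  | add x y _ _ hx hy => exact add_mem (hx trivial) (hy trivial)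
  | smul r x _ hx =>
    exact smul_mem_of_forall_of_smul_mem
      ((moduleRepresentation M J).stableSpan ⊤ F).toAddSubgroup
      (fun g y hy => (Representation.submoduleStabilizer_stableSpan (Subgroup.mem_top g) y).2 hy) r
      (hx trivial)

end

/-- Finitely generated modules over the integral group ring of a finitely generated nilpotent group
are noetherian. -/
theorem isNoetherian_of_centralPolycyclic [A.Normal] (hA : ∀ a ∈ A, ∀ x : M, of ℤ G a • x = x)
    (hG : CentralPolycyclic A ⊤) [Module.Finite ℤ[G] M] : IsNoetherian ℤ[G] M := by
  obtain ⟨s, hs⟩ := Module.Finite.fg_top (R := ℤ[G]) (M := M)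
  rw [← monotone_stabilizes_iff_noetherian]
  intro f
  obtain ⟨n, hn⟩ := Representation.stableACC_of_centralPolycyclic
    (ρ := moduleRepresentation M ℤ) hA hG s s.finite_toSet
    (fun i => (f i).toAddSubgroup.toIntSubmodule) (fun i j hij x hx => f.monotone hij hx)
    (fun i => Representation.le_submoduleStabilizer fun k _ x hx => (f i).smul_mem _ hx)
    (fun i => by rw [stableSpan_moduleRepresentation_eq_top hs]; exact le_top)
  exact ⟨n, fun m hm => le_antisymm (f.monotone hm) (hn m hm)⟩

theorem isNoetherian_of_fg [A.Normal] (hA : ∀ a ∈ A, ∀ x : M, of ℤ G a • x = x)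
    (hG : CentralPolycyclic A ⊤) {U : Submodule ℤ[G] M} (hU : U.FG) : IsNoetherian ℤ[G] U :=
  have := Module.Finite.iff_fg.2 hU
  isNoetherian_of_centralPolycyclic (fun a ha x => Subtype.ext (hA a ha x)) hG

/-- Over a Jacobson domain that is not a field, a nonzero torsion-free module with a commuting
action of a finitely generated nilpotent group, finitely generated as such, has a submodule `gM`
with `g ≠ 0` that contains no `sᵏM`. -/
theorem exists_not_forall_pow_smul_mem [A.Normal] (hA : ∀ a ∈ A, ∀ x : M, of ℤ G a • x = x)
    (hG : CentralPolycyclic A ⊤) [Module.Finite ℤ[G] M] [Nontrivial M]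
    {J : Type*} [CommRing J] [IsDomain J] [IsNoetherianRing J] [IsJacobsonRing J]
    (hJ : ¬ IsField J) [Module J M] [SMulCommClass ℤ[G] J M]
    (htf : ∀ (j : J) (x : M), j • x = 0 → j = 0 ∨ x = 0) {s : J} (hs : s ≠ 0) :
    ∃ g : J, g ≠ 0 ∧ ∀ k : ℕ, ∃ x : M, ∀ y : M, s ^ k • x ≠ g • y := by
  by_contra! hdiv
  obtain ⟨F, hF⟩ := Module.Finite.fg_top (R := ℤ[G]) (M := M)
  obtain ⟨f, hf, hfree⟩ := Representation.stableGenericFreeness_of_centralPolycyclic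
    (ρ := moduleRepresentation M J) hA hG ⊥
    (Representation.le_submoduleStabilizer fun k _ x hx => by
      rw [Submodule.mem_bot] at hx ⊢; rw [hx, map_zero]) F F.finite_toSet
  rw [stableSpan_moduleRepresentation_eq_top hF, sup_top_eq] at hfree
  have hjac : (⊥ : Ideal J).jacobson = ⊥ := isJacobsonRing_iff_prime_eq.1 ‹_› _ Ideal.isPrime_bot
  have hfs : f * s ∉ (⊥ : Ideal J).jacobson := by
    rw [hjac]; exact mul_ne_zero hf hs
  obtain ⟨m, hm, hfsm⟩ : ∃ m : Ideal J, m.IsMaximal ∧ f * s ∉ m := by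
    by_contra! h
    exact hfs (Ideal.mem_sInf.2 fun {m} hm => h m hm.2)
  have hfm : f ∉ m := fun h => hfsm (m.mul_mem_right s h)
  have hsm : s ∉ m := fun h => hfsm (m.mul_mem_left f h)
  obtain ⟨g, hgm, hg⟩ := Submodule.exists_mem_ne_zero_of_ne_bot
    (Ring.ne_bot_of_isMaximal_of_not_isField hm hJ)
  obtain ⟨k, hk⟩ := hdiv g hg
  obtain ⟨a, c, hc, hac⟩ := hm.exists_inv (mt (hm.isPrime.mem_of_pow_mem k) hsm)
  have htop : (⊤ : Submodule J M) ≤ m • ⊤ := by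
    intro x _
    obtain ⟨y, hy⟩ := hk x
    have : x = g • a • y + c • x := by
      rw [smul_comm, ← hy, smul_smul, ← add_smul, hac, one_smul]
    rw [this]
    exact add_mem (Submodule.smul_mem_smul hgm trivial) (Submodule.smul_mem_smul hc trivial)
  obtain ⟨x, hx⟩ := exists_ne (0 : M)
  have := hm.isPrime
  obtain ⟨l, hl⟩ := hfree.exists_pow_smul_eq_zero hfm htop x
  exact (htf _ _ hl).elim (pow_ne_zero l hf) hx

section Augmentation

variable {M' : Type*} [AddCommGroup M'] [Module ℤ[G] M'] {U V N : Submodule ℤ[G] M}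

/-- The submodule `I U`, where `I` is the augmentation ideal of the integral group ring. -/
noncomputable def augmentation (U : Submodule ℤ[G] M) : Submodule ℤ[G] M :=
  Submodule.span ℤ[G] {x | ∃ g : G, ∃ u ∈ U, of ℤ G g • u - u = x}

theorem sub_mem_augmentation (g : G) {u : M} (hu : u ∈ U) :
    of ℤ G g • u - u ∈ augmentation U :=
  Submodule.subset_span ⟨g, u, hu, rfl⟩

theorem augmentation_le : augmentation U ≤ N ↔ ∀ g : G, ∀ u ∈ U, of ℤ G g • u - u ∈ N := by
  refine ⟨fun h g u hu => h (sub_mem_augmentation g hu), fun h => Submodule.span_le.2 ?_⟩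
  rintro _ ⟨g, u, hu, rfl⟩
  exact h g u hu

theorem augmentation_le_self (U : Submodule ℤ[G] M) : augmentation U ≤ U :=
  augmentation_le.2 fun _ _ hu => sub_mem (U.smul_mem _ hu) hu

theorem augmentation_mono : Monotone (augmentation : Submodule ℤ[G] M → Submodule ℤ[G] M) :=
  fun _ _ h => augmentation_le.2 fun g _ hu => sub_mem_augmentation g (h hu)

theorem iterate_augmentation_antitone (U : Submodule ℤ[G] M) :
    Antitone fun n => augmentation^[n] U :=
  antitone_nat_of_succ_le fun n => by
    rw [Function.iterate_succ_apply']
    exact augmentation_le_self _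

theorem map_augmentation (f : M →ₗ[ℤ[G]] M') (U : Submodule ℤ[G] M) :
    (augmentation U).map f = augmentation (U.map f) := by
  refine le_antisymm (Submodule.map_le_iff_le_comap.2 (augmentation_le.2 fun g u hu => ?_))
    (augmentation_le.2 ?_)
  · rw [Submodule.mem_comap, map_sub, map_smul]
    exact sub_mem_augmentation g (Submodule.mem_map_of_mem hu)
  · rintro g _ ⟨u, hu, rfl⟩
    exact ⟨_, sub_mem_augmentation g hu, by rw [map_sub, map_smul]⟩

theorem map_iterate_augmentation (f : M →ₗ[ℤ[G]] M') (n : ℕ) (U : Submodule ℤ[G] M) :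
    (augmentation^[n] U).map f = augmentation^[n] (U.map f) :=
  (Function.Semiconj.iterate_right (f := Submodule.map f) (map_augmentation f) n) U

/-- The iterated augmentations of `V` are nonzero, and every nonzero submodule contains one. -/
structure AugmentationCofinal (V : Submodule ℤ[G] M) : Prop where
  ne_bot : ∀ n, augmentation^[n] V ≠ ⊥
  exists_le : ∀ N : Submodule ℤ[G] M, N ≠ ⊥ → ∃ n, augmentation^[n] V ≤ N

theorem AugmentationCofinal.iterate (hV : AugmentationCofinal V) (n : ℕ) :
    AugmentationCofinal (augmentation^[n] V) where
  ne_bot m := by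
    rw [← Function.iterate_add_apply]
    exact hV.ne_bot _
  exists_le N hN := by
    obtain ⟨m, hm⟩ := hV.exists_le N hN
    refine ⟨m, ?_⟩
    rw [← Function.iterate_add_apply]
    exact (iterate_augmentation_antitone V (Nat.le_add_right m n)).trans hm

theorem AugmentationCofinal.submoduleOf (hV : AugmentationCofinal V) {D : Submodule ℤ[G] M}
    (hVD : V ≤ D) : AugmentationCofinal (V.submoduleOf D) := by
  have hmap : (V.submoduleOf D).map D.subtype = V := by
    rw [Submodule.submoduleOf, Submodule.map_comap_subtype, inf_eq_right.2 hVD]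
  refine ⟨fun n h => hV.ne_bot n ?_, fun N hN => ?_⟩
  · rw [← hmap, ← map_iterate_augmentation, h, Submodule.map_bot]
  · obtain ⟨n, hn⟩ := hV.exists_le (N.map D.subtype)
      fun h => hN (Submodule.map_injective_of_injective D.subtype_injective
        (h.trans (Submodule.map_bot _).symm))
    refine ⟨n, ?_⟩
    rwa [← hmap, ← map_iterate_augmentation,
      Submodule.map_le_map_iff_of_injective D.subtype_injective] at hn

/-- An endomorphism killing some iterated augmentation of `V` is nilpotent on noetherian
submodules. -/
theorem AugmentationCofinal.exists_pow_apply_eq_zero (hV : AugmentationCofinal V)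
    [IsNoetherian ℤ[G] U] (θ : Module.End ℤ[G] M) (hθ : ∀ x ∈ U, θ x ∈ U) {c : ℕ}
    (hc : augmentation^[c] V ≤ LinearMap.ker θ) : ∃ n, ∀ x ∈ U, (θ ^ n) x = 0 := by
  obtain ⟨n, hn, hdisj⟩ := ((Filter.eventually_ge_atTop 1).and
    (Module.End.eventually_disjoint_ker_pow_range_pow (θ.restrict hθ))).exists
  refine ⟨n, ?_⟩
  by_contra! h
  obtain ⟨x, hx, hx0⟩ := h
  have hpow : ∀ (m : ℕ) (y : U), (((θ.restrict hθ) ^ m) y : M) = (θ ^ m) y := by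
    intro m y
    rw [Module.End.pow_restrict]
    rfl
  obtain ⟨m, hm⟩ := hV.exists_le ((LinearMap.range (θ.restrict hθ ^ n)).map U.subtype) (by
    intro h
    refine hx0 ?_
    rw [← Submodule.mem_bot ℤ[G], ← h]
    exact ⟨_, ⟨⟨x, hx⟩, rfl⟩, hpow n _⟩)
  obtain ⟨y, hy, hy0⟩ := Submodule.exists_mem_ne_zero_of_ne_bot (hV.ne_bot (max m c))
  obtain ⟨w, hw, rfl⟩ := hm (iterate_augmentation_antitone V (le_max_left m c) hy)
  have hker : θ w = 0 := hc (iterate_augmentation_antitone V (le_max_right m c) hy)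
  refine hy0 ?_
  have : w ∈ LinearMap.ker (θ.restrict hθ ^ n) := by
    rw [LinearMap.mem_ker, Subtype.ext_iff, hpow, ← Nat.sub_add_cancel hn, pow_succ,
      Module.End.mul_apply, hker, map_zero, Submodule.coe_zero]
  rw [Submodule.disjoint_def.1 hdisj w this hw, map_zero]

section Polynomial

open Polynomial in
theorem aeval_apply_eq_smul {z : G} {ζ : Module.End ℤ[G] M} (hζ : ∀ x, ζ x = of ℤ G z • x)
    (p : Polynomial ℤ) (x : M) : aeval ζ p x = aeval (of ℤ G z) p • x := by
  induction p using Polynomial.induction_on' with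
  | add p q hp hq => rw [map_add, map_add, LinearMap.add_apply, hp, hq, add_smul]
  | monomial n a =>
    rw [aeval_monomial, aeval_monomial, Module.End.mul_apply, mul_smul]
    have hpow : (ζ ^ n) x = of ℤ G z ^ n • x := by
      induction n with
      | zero => simp
      | succ n ih => rw [pow_succ', Module.End.mul_apply, ih, hζ, pow_succ', mul_smul]
    rw [hpow, Module.algebraMap_end_apply, algebraMap_smul]

variable {z : G} {ζ : Module.End ℤ[G] M}

variable (V ζ) in
/-- The polynomials in `ζ` that kill some iterated augmentation of `V`. -/
def eventualAnnihilator : Ideal (Polynomial ℤ) where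
  carrier := {p | ∃ n, augmentation^[n] V ≤ LinearMap.ker (Polynomial.aeval ζ p)}
  zero_mem' := ⟨0, fun x _ => by simp⟩
  add_mem' := by
    rintro p q ⟨m, hm⟩ ⟨n, hn⟩
    refine ⟨max m n, fun x hx => ?_⟩
    rw [LinearMap.mem_ker, map_add, LinearMap.add_apply,
      hm (iterate_augmentation_antitone V (le_max_left m n) hx),
      hn (iterate_augmentation_antitone V (le_max_right m n) hx), add_zero]
  smul_mem' := by
    rintro p q ⟨m, hm⟩
    refine ⟨m, fun x hx => ?_⟩
    rw [LinearMap.mem_ker, smul_eq_mul, map_mul, Module.End.mul_apply, hm hx, map_zero]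

theorem AugmentationCofinal.isPrime_eventualAnnihilator (hV : AugmentationCofinal V) :
    (eventualAnnihilator V ζ).IsPrime := by
  refine ⟨fun h => ?_, fun {p q} hpq => ?_⟩
  · obtain ⟨n, hn⟩ := (Ideal.eq_top_iff_one _).1 h
    exact hV.ne_bot n (eq_bot_iff.2 fun x hx => by simpa using hn hx)
  · rw [or_iff_not_imp_right]
    intro hq
    obtain ⟨m, hm⟩ := hpq
    obtain ⟨n, hn⟩ := hV.exists_le ((augmentation^[m] V).map (Polynomial.aeval ζ q)) (by
      intro h
      exact hq ⟨m, LinearMap.le_ker_iff_map.2 h⟩)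
    refine ⟨n, hn.trans ?_⟩
    rintro _ ⟨x, hx, rfl⟩
    have := hm hx
    rwa [LinearMap.mem_ker, map_mul, Module.End.mul_apply] at this

theorem pow_sub_one_apply_mem (hζ : ∀ x, ζ x = of ℤ G z • x) (k : ℕ) {x : M} (hx : x ∈ U) :
    ((ζ - 1) ^ k) x ∈ augmentation^[k] U := by
  induction k with
  | zero => exact hx
  | succ k ih =>
    rw [pow_succ', Module.End.mul_apply, Function.iterate_succ_apply', LinearMap.sub_apply, hζ]
    exact sub_mem_augmentation z ih

/-- The eventual annihilator is uniform, since it is finitely generated. -/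
theorem exists_forall_mem_eventualAnnihilator :
    ∃ n, ∀ p ∈ eventualAnnihilator V ζ, ∀ x ∈ augmentation^[n] V, Polynomial.aeval ζ p x = 0 := by
  obtain ⟨s, hs⟩ := IsNoetherian.noetherian (eventualAnnihilator V ζ)
  have hmem : ∀ p : s, ∃ n, augmentation^[n] V ≤ LinearMap.ker (Polynomial.aeval ζ p.1) := by
    intro p
    have : p.1 ∈ eventualAnnihilator V ζ := hs ▸ Submodule.subset_span p.2
    exact this
  choose n hn using hmem
  refine ⟨Finset.univ.sup n, fun p hp x hx => ?_⟩
  rw [← hs] at hp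
  induction hp using Submodule.span_induction with
  | mem p hp =>
    exact hn ⟨p, hp⟩ (iterate_augmentation_antitone V (Finset.le_sup (Finset.mem_univ _)) hx)
  | zero => simp
  | add p q _ _ hp hq => rw [map_add, LinearMap.add_apply, hp, hq, add_zero]
  | smul r p _ hp => rw [smul_eq_mul, map_mul, Module.End.mul_apply, hp, map_zero]

variable [A.Normal]

theorem AugmentationCofinal.isMaximal_eventualAnnihilator (hV : AugmentationCofinal V)
    (hA : ∀ a ∈ A, ∀ x : M, of ℤ G a • x = x) (hG : CentralPolycyclic A ⊤) (hfg : V.FG)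
    (hζ : ∀ x, ζ x = of ℤ G z • x)
    (hX : (Polynomial.X - 1 : Polynomial ℤ) ∉ eventualAnnihilator V ζ) :
    (eventualAnnihilator V ζ).IsMaximal := by
  have hprime := hV.isPrime_eventualAnnihilator (ζ := ζ)
  by_contra hmax
  obtain ⟨n, hn⟩ := exists_forall_mem_eventualAnnihilator (V := V) (ζ := ζ)
  set P := eventualAnnihilator V ζ with hP
  set W := augmentation^[n] V with hW
  have hWfg : Module.Finite ℤ[G] W := by
    have := isNoetherian_of_fg hA hG hfg
    exact Module.Finite.iff_fg.2
      (Submodule.FG.of_le_of_isNoetherian (T := V)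
        (iterate_augmentation_antitone V (Nat.zero_le n)))
  have hWnt : Nontrivial W := Submodule.nontrivial_iff_ne_bot.2 (hV.ne_bot n)
  have hζW : ∀ x ∈ W, ζ x ∈ W := fun x hx => hζ x ▸ W.smul_mem _ hx
  have hcoe : ∀ (p : Polynomial ℤ) (w : W),
      (Polynomial.aeval (ζ.restrict hζW) p w : M) = Polynomial.aeval ζ p w := by
    intro p w
    rw [aeval_apply_eq_smul hζ, aeval_apply_eq_smul fun x => Subtype.ext (hζ x),
      Submodule.coe_smul]
  have hker : ∀ p ∈ P, (Polynomial.aeval (ζ.restrict hζW) : _ →ₐ[ℤ] _).toRingHom p = 0 :=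
    fun p hp => LinearMap.ext fun w => Subtype.ext ((hcoe p w).trans (hn p hp w w.2))
  let : Module (Polynomial ℤ ⧸ P) W := Module.compHom W (Ideal.Quotient.lift P _ hker)
  have hsmul : ∀ (p : Polynomial ℤ) (w : W),
      ((Ideal.Quotient.mk P p • w : W) : M) = Polynomial.aeval ζ p w := hcoe
  have : SMulCommClass ℤ[G] (Polynomial ℤ ⧸ P) W := ⟨fun r j w => by
    obtain ⟨p, rfl⟩ := Ideal.Quotient.mk_surjective j
    refine Subtype.ext ?_
    rw [Submodule.coe_smul, hsmul, hsmul, Submodule.coe_smul, map_smul]⟩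
  have := Int.isJacobsonRing
  have hs0 : Ideal.Quotient.mk P (Polynomial.X - 1) ≠ 0 := by
    rwa [Ne, Ideal.Quotient.eq_zero_iff_mem]
  obtain ⟨g, hg, hdiv⟩ := exists_not_forall_pow_smul_mem (M := W)
    (fun a ha x => Subtype.ext (hA a ha x)) hG (J := Polynomial ℤ ⧸ P)
    (fun h => hmax (Ideal.Quotient.maximal_of_isField P h))
    (by
      intro j w hjw
      obtain ⟨p, rfl⟩ := Ideal.Quotient.mk_surjective j
      rw [or_iff_not_imp_right]
      intro hw
      rw [Ideal.Quotient.eq_zero_iff_mem]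
      refine hV.exists_le _ fun h => hw (Subtype.ext ?_)
      rw [Submodule.coe_zero, ← Submodule.mem_bot ℤ[G], ← h, LinearMap.mem_ker, ← hsmul, hjw,
        Submodule.coe_zero]) hs0
  obtain ⟨p, rfl⟩ := Ideal.Quotient.mk_surjective g
  obtain ⟨m, hm⟩ := hV.exists_le (W.map (Polynomial.aeval ζ p)) (by
    intro h
    exact hg (Ideal.Quotient.eq_zero_iff_mem.2 ⟨n, LinearMap.le_ker_iff_map.2 h⟩))
  obtain ⟨w, hw⟩ := hdiv m
  have hmem : ((ζ - 1) ^ m) (w : M) ∈ augmentation^[m] V := by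
    refine iterate_augmentation_antitone V (Nat.le_add_right m n) ?_
    simp only [Function.iterate_add_apply]
    exact pow_sub_one_apply_mem hζ m w.2
  obtain ⟨y, hy, hyw⟩ := hm hmem
  refine hw ⟨y, hy⟩ (Subtype.ext ?_)
  rw [← map_pow, hsmul, hsmul, hyw, map_pow, map_sub, Polynomial.aeval_X, map_one]

/-- If `z` acts by an endomorphism `ζ` such that `ζ - 1` kills no iterated augmentation of `V`,
then all finitely generated submodules are perfect. -/
theorem AugmentationCofinal.augmentation_eq_self (hV : AugmentationCofinal V)
    (hA : ∀ a ∈ A, ∀ x : M, of ℤ G a • x = x) (hG : CentralPolycyclic A ⊤) (hfg : V.FG)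
    (hζ : ∀ x, ζ x = of ℤ G z • x) (hker : ∀ n, ¬ augmentation^[n] V ≤ LinearMap.ker (ζ - 1))
    (hU : U.FG) : augmentation U = U := by
  have hX : (Polynomial.X - 1 : Polynomial ℤ) ∉ eventualAnnihilator V ζ := by
    rintro ⟨n, hn⟩
    rw [map_sub, Polynomial.aeval_X, map_one] at hn
    exact hker n hn
  have hmax := hV.isMaximal_eventualAnnihilator hA hG hfg hζ hX
  obtain ⟨a, h, ⟨c, hc⟩, hah⟩ := hmax.exists_inv hX
  have hmem : ∀ (p : Polynomial ℤ), ∀ x ∈ U, Polynomial.aeval ζ p x ∈ U :=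
    fun p x hx => aeval_apply_eq_smul hζ p x ▸ U.smul_mem _ hx
  have := isNoetherian_of_fg hA hG hU
  obtain ⟨n, hn⟩ := hV.exists_pow_apply_eq_zero (U := U) _ (hmem h) hc
  refine le_antisymm (augmentation_le_self U) fun x hx => ?_
  obtain ⟨b, hb⟩ := sub_dvd_pow_sub_pow 1 h n
  have key : (1 : Polynomial ℤ) = (Polynomial.X - 1) * (a * b) + h ^ n := by
    rw [one_pow] at hb
    linear_combination hb - b * hah
  have hx' : x = ζ (Polynomial.aeval ζ (a * b) x) - Polynomial.aeval ζ (a * b) x := by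
    have := congrArg (fun p => Polynomial.aeval ζ p x) key
    simpa only [map_one, map_add, map_mul (Polynomial.aeval ζ) (Polynomial.X - 1 : Polynomial ℤ),
      map_sub, Polynomial.aeval_X, map_pow,
      LinearMap.add_apply, hn x hx, add_zero, Module.End.one_apply,
      Module.End.mul_apply, LinearMap.sub_apply] using this
  rw [hx', hζ]
  exact sub_mem_augmentation z (hmem _ x hx)

end Polynomial

section FixedPoints

/-- The elements acting trivially on a submodule. -/
def pointwiseStabilizer (N : Submodule ℤ[G] M) : Subgroup G where
  carrier := {g | ∀ x ∈ N, of ℤ G g • x = x}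
  one_mem' x _ := by rw [map_one, one_smul]
  mul_mem' {g h} hg hh x hx := by rw [map_mul, mul_smul, hh x hx, hg x hx]
  inv_mem' {g} hg x hx := by
    nth_rw 1 [← hg x hx]
    rw [smul_smul, ← map_mul, inv_mul_cancel, map_one, one_smul]

variable (M) in
/-- The submodule of points fixed by a normal subgroup. -/
noncomputable def fixedSubmodule (K : Subgroup G) [hK : K.Normal] : Submodule ℤ[G] M where
  carrier := {x | ∀ k ∈ K, of ℤ G k • x = x}
  zero_mem' k _ := smul_zero _
  add_mem' hx hy k hk := by rw [smul_add, hx k hk, hy k hk]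
  smul_mem' r x hx := by
    refine smul_mem_of_forall_of_smul_mem
      (⟨⟨⟨{x : M | ∀ k ∈ K, of ℤ G k • x = x}, ?_⟩, ?_⟩, ?_⟩ : AddSubgroup M) ?_ r hx
    · exact fun hx hy k hk => by rw [smul_add, hx k hk, hy k hk]
    · exact fun k _ => smul_zero _
    · exact fun hx k hk => by rw [smul_neg, hx k hk]
    · intro g x hx k hk
      have := hx _ (hK.conj_mem k hk g⁻¹)
      rw [inv_inv, map_mul, map_mul, mul_smul, mul_smul] at this
      nth_rw 2 [← this]
      rw [smul_smul (of ℤ G g) (of ℤ G g⁻¹), ← map_mul, mul_inv_cancel, map_one, one_smul]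

variable {K : Subgroup G} [hK : K.Normal] {N : Submodule ℤ[G] M}

theorem le_fixedSubmodule_iff : N ≤ fixedSubmodule M K ↔ K ≤ pointwiseStabilizer N :=
  ⟨fun h k hk _ hx => h hx k hk, fun h x hx _ hk => h hk x hx⟩

/-- An element that is central modulo `K` acts by an endomorphism on the points fixed by `K`. -/
theorem exists_end_fixedSubmodule {z : G} (hz : ∀ g, ⁅z, g⁆ ∈ K) :
    ∃ ζ : Module.End ℤ[G] (fixedSubmodule M K), ∀ x, ζ x = of ℤ G z • x := by
  let ζ : fixedSubmodule M K →+ fixedSubmodule M K := DistribSMul.toAddMonoidHom _ (of ℤ G z)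
  refine ⟨⟨ζ.toAddHom, fun r x => ?_⟩, fun x => rfl⟩
  change of ℤ G z • r • x = r • of ℤ G z • x
  induction r using MonoidAlgebra.induction_on with
  | of g =>
    have h := (of ℤ G g • of ℤ G z • x).2 _ (hz g)
    refine Subtype.ext (Eq.trans ?_ h)
    rw [Submodule.coe_smul, Submodule.coe_smul, Submodule.coe_smul, Submodule.coe_smul,
      smul_smul, smul_smul, smul_smul, ← map_mul, ← map_mul, ← map_mul, commutatorElement_def]
    congr 2
    group
  | add a b ha hb => rw [add_smul, smul_add, ha, hb, add_smul]
  | smul n a ha => rw [smul_assoc, smul_comm, ha, smul_assoc]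

end FixedPoints

theorem augmentation_map_eq_iff {f : M →ₗ[ℤ[G]] M'} (hf : Function.Injective f) :
    augmentation (U.map f) = U.map f ↔ augmentation U = U := by
  rw [← map_augmentation, (Submodule.map_injective_of_injective hf).eq_iff]

/-- If `φ` is nilpotent on a finitely generated submodule `U`, then `U` is perfect as soon as all
finitely generated submodules of the kernel of `φ` are. -/
theorem augmentation_eq_self_of_pow_apply_eq_zero [IsNoetherian ℤ[G] U] (φ : Module.End ℤ[G] M)
    (h : ∀ N : Submodule ℤ[G] M, N.FG → N ≤ LinearMap.ker φ → augmentation N = N) {n : ℕ}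
    (hn : ∀ x ∈ U, (φ ^ n) x = 0) : augmentation U = U := by
  induction n generalizing U with
  | zero =>
    have : U = ⊥ := eq_bot_iff.2 hn
    rw [this]
    exact le_bot_iff.1 (augmentation_le_self _)
  | succ n ih =>
    refine le_antisymm (augmentation_le_self U) fun x hx => ?_
    have : IsNoetherian ℤ[G] (U.map φ) := isNoetherian_map φ
    have himage : (augmentation U).map φ = U.map φ := by
      rw [map_augmentation]
      refine ih ?_
      rintro _ ⟨y, hy, rfl⟩
      rw [← Module.End.mul_apply, ← pow_succ]
      exact hn y hy
    obtain ⟨y, hy, hyx⟩ := himage.ge (Submodule.mem_map_of_mem hx)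
    have hker := h (U ⊓ LinearMap.ker φ) (Submodule.FG.of_le_of_isNoetherian inf_le_left)
      inf_le_right
    have hxy : x - y ∈ U ⊓ LinearMap.ker φ :=
      ⟨sub_mem hx (augmentation_le_self U hy), LinearMap.mem_ker.2 (by rw [map_sub, hyx, sub_self])⟩
    rw [← hker] at hxy
    rw [← sub_add_cancel x y]
    exact add_mem (augmentation_mono inf_le_left hxy) hy

theorem AugmentationCofinal.augmentation_top_eq_top [A.Normal] (hV : AugmentationCofinal V)
    (hA : ∀ a ∈ A, ∀ x : M, of ℤ G a • x = x) (hG : CentralPolycyclic A ⊤) (hfg : V.FG) :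
    augmentation (⊤ : Submodule ℤ[G] M) = ⊤ := by
  suffices h : ∀ N : Submodule ℤ[G] M, N.FG → augmentation N = N by
    refine eq_top_iff.2 fun x _ => augmentation_mono (a := Submodule.span ℤ[G] {x}) le_top ?_
    rw [h _ (Submodule.fg_span_singleton x)]
    exact Submodule.mem_span_singleton_self x
  by_contra hnot
  suffices key : ∀ K, CentralPolycyclic A K →
      (∃ n, K ≤ pointwiseStabilizer (augmentation^[n] V)) ∧
      ((∀ N : Submodule ℤ[G] M, N.FG → K ≤ pointwiseStabilizer N → augmentation N = N) →
        ∀ N : Submodule ℤ[G] M, N.FG → augmentation N = N) by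
    obtain ⟨⟨n, hn⟩, -⟩ := key ⊤ hG
    refine hV.ne_bot (n + 1) ?_
    rw [Function.iterate_succ_apply', eq_bot_iff, augmentation_le]
    intro g u hu
    rw [hn (Subgroup.mem_top g) u hu, sub_self]
    exact zero_mem _
  intro K hK
  induction hK with
  | base => exact ⟨⟨0, fun a ha x _ => hA a ha x⟩, fun h N hN => h N hN fun a ha x _ => hA a ha x⟩
  | @step K z hK hz ih =>
    obtain ⟨⟨n, hn⟩, hperf⟩ := ih
    have := hK.normal
    obtain ⟨ζ, hζ⟩ := exists_end_fixedSubmodule (M := M) hz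
    let D := fixedSubmodule M K
    have hinj := D.subtype_injective
    have hAD : ∀ a ∈ A, ∀ x : D, of ℤ G a • x = x := fun a ha x => Subtype.ext (hA a ha x)
    have hW := hV.iterate n
    set W := augmentation^[n] V
    have hWD : W ≤ D := le_fixedSubmodule_iff.2 hn
    have hmap : ∀ N ≤ D, (N.submoduleOf D).map D.subtype = N := fun N hN => by
      rw [Submodule.submoduleOf, Submodule.map_comap_subtype, inf_eq_right.2 hN]
    have hfgof : ∀ N ≤ D, N.FG → (N.submoduleOf D).FG := fun N hN hN' =>
      Submodule.fg_of_fg_map_injective _ hinj (by rwa [hmap N hN])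
    have hWfg : W.FG := by
      have := isNoetherian_of_fg hA hG hfg
      exact Submodule.FG.of_le_of_isNoetherian (T := V)
        (iterate_augmentation_antitone V (Nat.zero_le n))
    have hWcof := hW.submoduleOf hWD
    by_cases hker : ∃ m, augmentation^[m] (W.submoduleOf D) ≤ LinearMap.ker (ζ - 1)
    · obtain ⟨m, hm⟩ := hker
      refine ⟨⟨m + n, sup_le (hn.trans ?_) ?_⟩, fun h => hperf fun N hN hKN => ?_⟩
      · exact fun k hk x hx => hk x (iterate_augmentation_antitone V (Nat.le_add_left n m) hx)
      · rw [Subgroup.zpowers_le]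
        intro x hx
        rw [Function.iterate_add_apply] at hx
        change x ∈ augmentation^[m] W at hx
        rw [← hmap W hWD, ← map_iterate_augmentation] at hx
        obtain ⟨y, hy, rfl⟩ := hx
        have := hm hy
        rw [LinearMap.mem_ker, LinearMap.sub_apply, hζ, Module.End.one_apply, sub_eq_zero] at this
        exact congrArg Subtype.val this
      · have hND : N ≤ D := le_fixedSubmodule_iff.2 hKN
        have := isNoetherian_of_fg hAD hG (hfgof N hND hN)
        obtain ⟨l, hl⟩ := hWcof.exists_pow_apply_eq_zero (U := N.submoduleOf D) (ζ - 1)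
          (fun x hx => by
            rw [LinearMap.sub_apply, hζ]
            exact sub_mem (Submodule.smul_mem _ _ hx) hx) hm
        rw [← hmap N hND, augmentation_map_eq_iff hinj]
        refine augmentation_eq_self_of_pow_apply_eq_zero (ζ - 1) (fun L hL hLker => ?_) hl
        rw [← augmentation_map_eq_iff hinj]
        refine h _ (hL.map _) (sup_le ?_ ?_)
        · exact le_fixedSubmodule_iff.1 (Submodule.map_subtype_le _ _)
        · rw [Subgroup.zpowers_le]
          rintro _ ⟨y, hy, rfl⟩
          have := hLker hy
          rw [LinearMap.mem_ker, LinearMap.sub_apply, hζ, Module.End.one_apply, sub_eq_zero] at this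
          exact congrArg Subtype.val this
    · rw [not_exists] at hker
      refine absurd (hperf fun N hN hKN => ?_) hnot
      have hND : N ≤ D := le_fixedSubmodule_iff.2 hKN
      rw [← hmap N hND, augmentation_map_eq_iff hinj]
      exact hWcof.augmentation_eq_self hAD hG (hfgof W hWD hWfg) hζ hker (hfgof N hND hN)

/-- A module over the integral group ring of a finitely generated nilpotent group in which no
proper submodule supplements `I M` is locally annihilated by powers of the augmentation ideal
`I`. -/
theorem exists_iterate_augmentation_eq_bot [A.Normal]
    (hA : ∀ a ∈ A, ∀ x : M, of ℤ G a • x = x) (hG : CentralPolycyclic A ⊤)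
    (h : ∀ C : Submodule ℤ[G] M, C ⊔ augmentation ⊤ = ⊤ → C = ⊤) (hU : U.FG) :
    ∃ n, augmentation^[n] U = ⊥ := by
  by_contra! hne
  have hfg : ∀ n, (augmentation^[n] U).FG := fun n => by
    have := isNoetherian_of_fg hA hG hU
    exact Submodule.FG.of_le_of_isNoetherian (T := U)
      (iterate_augmentation_antitone U (Nat.zero_le n))
  obtain ⟨C, -, hC⟩ := zorn_le_nonempty₀ {C : Submodule ℤ[G] M | ∀ n, ¬ augmentation^[n] U ≤ C}
    (fun c hc hchain y hy => by
      refine ⟨sSup c, fun n hn => ?_, fun N hN => le_sSup hN⟩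
      obtain ⟨N, hN, hnN⟩ := (Submodule.fg_iff_compact _).1 (hfg n) c _ ⟨y, hy⟩ hchain.directedOn
        (isLUB_sSup c) hn
      exact hc hN n hnN) ⊥ (fun n hn => hne n (le_bot_iff.1 hn))
  have hcof : AugmentationCofinal (U.map C.mkQ) := by
    refine ⟨fun n hn => ?_, fun N hN => ?_⟩
    · rw [← map_iterate_augmentation, ← LinearMap.le_ker_iff_map, Submodule.ker_mkQ] at hn
      exact hC.prop n hn
    · by_contra! hnN
      refine hN ?_
      have hle : N.comap C.mkQ ≤ C := hC.le_of_ge (fun n hn => hnN n (by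
        rwa [← map_iterate_augmentation, Submodule.map_le_iff_le_comap])) (C.le_comap_mkQ N)
      rw [← Submodule.map_comap_eq_of_surjective C.mkQ_surjective N,
        ← LinearMap.le_ker_iff_map, Submodule.ker_mkQ]
      exact hle
  have htop := hcof.augmentation_top_eq_top
    (fun a ha x => by
      obtain ⟨x, rfl⟩ := C.mkQ_surjective x
      rw [← map_smul, hA a ha x]) hG (hU.map _)
  have hsup : C ⊔ augmentation ⊤ = ⊤ := by
    have := congrArg (Submodule.comap C.mkQ) htop
    rwa [← C.range_mkQ, ← Submodule.map_top, ← map_augmentation, Submodule.comap_map_mkQ,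
      Submodule.map_top, C.range_mkQ, Submodule.comap_top] at this
  exact hC.prop 0 ((h C hsup).symm ▸ le_top)

end Augmentation

end MonoidAlgebra

section MinimalNormal

variable {G : Type*} [Group G] {A : Subgroup G}

/-- A group is contranormal-free if no proper subgroup has the whole group as normal closure. -/
def ContranormalFree (G : Type*) [Group G] : Prop :=
  ∀ H : Subgroup G, normalClosure (H : Set G) = ⊤ → H = ⊤

theorem ContranormalFree.of_surjective (h : ContranormalFree G) {Q : Type*} [Group Q] {f : G →* Q}
    (hf : Function.Surjective f) : ContranormalFree Q := by
  intro H hH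
  have hmap : (normalClosure (H.comap f : Set G)).map f = ⊤ := by
    rw [map_normalClosure _ f hf, coe_comap, Set.image_preimage_eq _ hf, hH]
  have hker : f.ker ≤ normalClosure (H.comap f : Set G) :=
    (ker_le_comap f H).trans le_normalClosure
  have htop := h (H.comap f) (by rw [← comap_map_eq_self hker, hmap, comap_top])
  rw [← map_comap_eq_self_of_surjective hf H, htop, map_top_of_surjective f hf]

theorem commutator_top_le_of_sup_eq_top [IsMulCommutative A] {N : Subgroup G} [hN : N.Normal]
    (h : N ⊔ A = ⊤) : ⁅A, (⊤ : Subgroup G)⁆ ≤ N := by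
  rw [commutator_le]
  intro a ha g _
  obtain ⟨n, hn, b, hb, rfl⟩ := mem_sup_of_normal_left.1 (h ▸ mem_top g)
  have hab : b * a⁻¹ = a⁻¹ * b := setLike_mul_comm hb (inv_mem ha)
  have : ⁅a, n * b⁆ = a * n * a⁻¹ * n⁻¹ := by
    rw [commutatorElement_def, mul_inv_rev, mul_assoc a, mul_assoc n, hab]
    group
  rw [this]
  exact mul_mem (hN.conj_mem n hn a) (inv_mem hn)

theorem eq_top_of_sup_eq_top [IsMulCommutative A] (hcomm : ⁅A, (⊤ : Subgroup G)⁆ = A)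
    {N : Subgroup G} [N.Normal] (h : N ⊔ A = ⊤) : N = ⊤ := by
  rw [← h, left_eq_sup, ← hcomm]
  exact commutator_top_le_of_sup_eq_top h

theorem center_eq_bot_of_minimal (hcomm : ⁅A, (⊤ : Subgroup G)⁆ = A) (hne : A ≠ ⊥)
    (hmin : ∀ N : Subgroup G, N.Normal → N ≠ ⊥ → A ≤ N) : center G = ⊥ := by
  by_contra h
  have := hmin _ inferInstance h
  rw [← centralizer_univ, ← coe_top, ← commutator_eq_bot_iff_le_centralizer, hcomm] at this
  exact hne this

section CentralModulo

variable {y : G}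

theorem conj_conj_of_commutator_mem_centralizer [hA : A.Normal]
    (hy : ∀ g, ⁅y, g⁆ ∈ centralizer (A : Set G)) (g : G) {a : G} (ha : a ∈ A) :
    y * (g * a * g⁻¹) * y⁻¹ = g * (y * a * y⁻¹) * g⁻¹ := by
  have hc := mem_centralizer_iff.1 (hy g) _ (hA.conj_mem _ (hA.conj_mem a ha y) g)
  rw [← mul_inv_eq_iff_eq_mul.2 hc.symm, commutatorElement_def]
  group

theorem eq_one_of_commute_of_minimal [hA : A.Normal]
    (hmin : ∀ N : Subgroup G, N.Normal → N ≠ ⊥ → A ≤ N)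
    (hy : ∀ g, ⁅y, g⁆ ∈ centralizer (A : Set G)) (hyA : y ∉ centralizer (A : Set G)) {a : G}
    (ha : a ∈ A) (hay : a * y = y * a) : a = 1 := by
  have hN : (A ⊓ centralizer {y}).Normal := by
    refine ⟨fun b hb g => ⟨hA.conj_mem b hb.1 g, ?_⟩⟩
    have hb' := mem_centralizer_singleton_iff.1 hb.2
    refine mem_centralizer_singleton_iff.2 ?_
    rw [eq_comm, ← mul_inv_eq_iff_eq_mul,
      conj_conj_of_commutator_mem_centralizer hy g hb.1, ← hb', mul_inv_cancel_right]
  by_contra h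
  refine hyA (mem_centralizer_iff.2 fun b hb => ?_)
  refine mem_centralizer_singleton_iff.1 (hmin _ hN (fun hbot => h ?_) hb).2
  rw [← mem_bot, ← hbot]
  exact ⟨ha, mem_centralizer_singleton_iff.2 hay⟩

theorem exists_commutator_eq_of_minimal [hA : A.Normal] [IsMulCommutative A]
    (hmin : ∀ N : Subgroup G, N.Normal → N ≠ ⊥ → A ≤ N)
    (hy : ∀ g, ⁅y, g⁆ ∈ centralizer (A : Set G)) (hyA : y ∉ centralizer (A : Set G)) {b : G}
    (hb : b ∈ A) : ∃ a ∈ A, ⁅y, a⁆ = b := by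
  let f : A →* G :=
    { toFun a := ⁅y, (a : G)⁆
      map_one' := by simp
      map_mul' a b := by
        have h : (a : G)⁻¹ * ⁅y, (b : G)⁆ = ⁅y, (b : G)⁆ * (a : G)⁻¹ :=
          setLike_mul_comm (inv_mem a.2) (mul_mem (hA.conj_mem b b.2 y) (inv_mem b.2))
        calc ⁅y, ((a * b : A) : G)⁆ = y * a * y⁻¹ * (⁅y, (b : G)⁆ * (a : G)⁻¹) := by
              rw [coe_mul, commutatorElement_def, commutatorElement_def]; group
          _ = ⁅y, (a : G)⁆ * ⁅y, (b : G)⁆ := by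
              rw [← h, ← mul_assoc, ← commutatorElement_def] }
  have hN : f.range.Normal := by
    refine ⟨?_⟩
    rintro _ ⟨a, rfl⟩ g
    refine ⟨⟨g * a * g⁻¹, hA.conj_mem a a.2 g⟩, ?_⟩
    change ⁅y, g * a * g⁻¹⁆ = g * ⁅y, (a : G)⁆ * g⁻¹
    rw [commutatorElement_def, conj_conj_of_commutator_mem_centralizer hy g a.2,
      commutatorElement_def]
    group
  have hle := hmin _ hN (by
    intro hbot
    refine hyA (mem_centralizer_iff.2 fun a ha => ?_)
    have : f ⟨a, ha⟩ ∈ (⊥ : Subgroup G) := hbot ▸ ⟨_, rfl⟩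
    exact (commutatorElement_eq_one_iff_mul_comm.1 (mem_bot.1 this)).symm)
  obtain ⟨a, ha⟩ := hle hb
  exact ⟨a, a.2, ha⟩

end CentralModulo

theorem CentralPolycyclic.eq_or_exists {K : Subgroup G} (h : CentralPolycyclic A K) :
    K = A ∨ ∃ z ∉ A, ∀ g, ⁅z, g⁆ ∈ A := by
  induction h with
  | base => exact Or.inl rfl
  | step z _ hz ih =>
    obtain hK | ih := ih
    · rw [hK] at hz ⊢
      by_cases hzA : z ∈ A
      · exact Or.inl (sup_eq_left.2 ((zpowers_le).2 hzA))
      · exact Or.inr ⟨z, hzA, hz⟩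
    · exact Or.inr ih

theorem le_centralizer_of_minimal [hA : A.Normal] [IsMulCommutative A]
    (hcomm : ⁅A, (⊤ : Subgroup G)⁆ = A) (hne : A ≠ ⊥)
    (hmin : ∀ N : Subgroup G, N.Normal → N ≠ ⊥ → A ≤ N) {z : G} (hzA : z ∉ A)
    (hz : ∀ g, ⁅z, g⁆ ∈ A) (hzc : z ∈ centralizer (A : Set G)) {K : Subgroup G}
    (hK : CentralPolycyclic A K) : K ≤ centralizer (A : Set G) ⊓ centralizer {z} := by
  have hcenter : ∀ c : G, (∀ g : G, c * g = g * c) → c = 1 := fun c hc => by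
    rw [← mem_bot, ← center_eq_bot_of_minimal hcomm hne hmin, mem_center_iff]
    exact fun g => (hc g).symm
  have hzA' : ∀ a ∈ A, a * z = z * a := mem_centralizer_iff.1 hzc
  induction hK with
  | base =>
    exact le_inf (fun a ha => mem_centralizer_iff.2 fun b hb => setLike_mul_comm hb ha)
      fun a ha => mem_centralizer_singleton_iff.2 (hzA' a ha)
  | @step K y hK hy ih =>
    have hyc : ∀ g, ⁅y, g⁆ ∈ centralizer (A : Set G) := fun g => (ih (hy g)).1
    have hyz : ∀ g, ⁅y, g⁆ * z = z * ⁅y, g⁆ :=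
      fun g => mem_centralizer_singleton_iff.1 (ih (hy g)).2
    have hyA : ∀ g, ∀ a ∈ A, ⁅y, g⁆ * a = a * ⁅y, g⁆ :=
      fun g a ha => (mem_centralizer_iff.1 (hyc g) a ha).symm
    by_cases hycA : y ∈ centralizer (A : Set G)
    · refine sup_le ih (zpowers_le.2 ⟨hycA, mem_centralizer_singleton_iff.2 ?_⟩)
      refine (commutatorElement_eq_one_iff_mul_comm.1 (hcenter ⁅z, y⁆ fun g => ?_)).symm
      have hconj : g * ⁅z, y⁆ * g⁻¹ =
          ⁅z, g⁆⁻¹ * (z * ⁅y, g⁆⁻¹ * y * z⁻¹) * ⁅z, g⁆⁻¹⁻¹ * y⁻¹ * ⁅y, g⁆⁻¹⁻¹ := by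
        simp only [commutatorElement_def]; group
      have hcomm_p : Commute ⁅z, g⁆⁻¹ (z * ⁅y, g⁆⁻¹ * y * z⁻¹) := by
        have hpz : Commute ⁅z, g⁆⁻¹ z := hzA' _ (inv_mem (hz g))
        have hpk : Commute ⁅z, g⁆⁻¹ ⁅y, g⁆⁻¹ :=
          (Commute.inv_right (hyA g _ (inv_mem (hz g))).symm)
        have hpy : Commute ⁅z, g⁆⁻¹ y := mem_centralizer_iff.1 hycA _ (inv_mem (hz g))
        exact ((hpz.mul_right hpk).mul_right hpy).mul_right hpz.inv_right
      have hzk : Commute z ⁅y, g⁆⁻¹ := Commute.inv_right (hyz g).symm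
      have hkb : Commute ⁅y, g⁆⁻¹ ⁅z, y⁆ := Commute.inv_left (hyA g _ (hz y))
      rw [hcomm_p.eq, mul_inv_cancel_right, hzk.eq] at hconj
      have : g * ⁅z, y⁆ * g⁻¹ = ⁅y, g⁆⁻¹ * ⁅z, y⁆ * ⁅y, g⁆⁻¹⁻¹ := by
        rw [hconj, commutatorElement_def z y]; group
      rw [hkb.eq, mul_inv_cancel_right] at this
      exact (mul_inv_eq_iff_eq_mul.1 this).symm
    · exfalso
      obtain ⟨a, ha, hab⟩ := exists_commutator_eq_of_minimal hmin hyc hycA (hz y)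
      have hwy : y * (z * a) = z * a * y := by
        calc y * (z * a) = ⁅z, y⁆⁻¹ * z * (y * a) := by rw [commutatorElement_def]; group
          _ = ⁅z, y⁆⁻¹ * (z * ⁅z, y⁆) * a * y := by
            nth_rw 3 [← hab]; rw [commutatorElement_def y a]; group
          _ = z * a * y := by rw [← hzA' _ (hz y), inv_mul_cancel_left]
      have hw : ∀ g : G, ⁅z * a, g⁆ = 1 := by
        intro g
        have hmem : ⁅z * a, g⁆ ∈ A := by
          have : ⁅z * a, g⁆ = z * (a * (g * a⁻¹ * g⁻¹)) * z⁻¹ * ⁅z, g⁆ := by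
            simp only [commutatorElement_def]; group
          rw [this]
          exact mul_mem (hA.conj_mem _ (mul_mem ha (hA.conj_mem _ (inv_mem ha) g)) z) (hz g)
        refine eq_one_of_commute_of_minimal hmin hyc hycA hmem ?_
        have hwk : Commute (z * a) ⁅y, g⁆ :=
          Commute.mul_left (hyz g).symm (hyA g a ha).symm
        have hconj : y * ⁅z * a, g⁆ * y⁻¹ = ⁅y, g⁆ * ⁅z * a, g⁆ * ⁅y, g⁆⁻¹ := by
          calc y * ⁅z * a, g⁆ * y⁻¹
              = y * (z * a) * y⁻¹ * (⁅y, g⁆ * g) * (y * (z * a) * y⁻¹)⁻¹ * (⁅y, g⁆ * g)⁻¹ := by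
                simp only [commutatorElement_def]; group
            _ = z * a * ⁅y, g⁆ * g * (z * a)⁻¹ * (⁅y, g⁆ * g)⁻¹ := by
                rw [hwy, mul_inv_cancel_right, ← mul_assoc]
            _ = ⁅y, g⁆ * ⁅z * a, g⁆ * ⁅y, g⁆⁻¹ := by
                rw [hwk.eq, commutatorElement_def (z * a)]; group
        rw [hyA g _ hmem, mul_inv_cancel_right, mul_inv_eq_iff_eq_mul] at hconj
        exact hconj.symm
      refine hzA ?_
      have := hcenter (z * a) fun g => commutatorElement_eq_one_iff_mul_comm.1 (hw g)
      rw [eq_inv_of_mul_eq_one_left this]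
      exact inv_mem ha

/-- A contranormal-free group has no nontrivial minimal abelian normal subgroup `A = ⁅A, G⁆` with
`G/A` finitely generated nilpotent that is contained in all nontrivial normal subgroups. -/
theorem ContranormalFree.eq_bot_of_minimal [A.Normal] [IsMulCommutative A]
    (hcf : ContranormalFree G) (hG : CentralPolycyclic A ⊤) (hcomm : ⁅A, (⊤ : Subgroup G)⁆ = A)
    (hmin : ∀ N : Subgroup G, N.Normal → N ≠ ⊥ → A ≤ N) : A = ⊥ := by
  by_contra hne
  have hnc : ¬ (⊤ : Subgroup G) ≤ centralizer (A : Set G) := by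
    rwa [← commutator_eq_bot_iff_le_centralizer, commutator_comm, hcomm]
  have hAc : A ≤ centralizer (A : Set G) :=
    fun a ha => mem_centralizer_iff.2 fun b hb => setLike_mul_comm hb ha
  obtain htop | ⟨z, hzA, hz⟩ := hG.eq_or_exists
  · exact hnc (htop ▸ hAc)
  by_cases hzc : z ∈ centralizer (A : Set G)
  · exact hnc ((le_centralizer_of_minimal hcomm hne hmin hzA hz hzc hG).trans inf_le_left)
  have hsup : normalClosure (centralizer {z} : Set G) ⊔ A = ⊤ := by
    refine eq_top_iff.2 fun g _ => ?_
    obtain ⟨a, ha, hab⟩ :=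
      exists_commutator_eq_of_minimal hmin (fun g => hAc (hz g)) hzc (inv_mem (hz g))
    have hmem : a * g ∈ centralizer {z} := by
      rw [mem_centralizer_singleton_iff]
      have hag : a * ⁅z, g⁆ = ⁅z, g⁆ * a := setLike_mul_comm ha (hz g)
      calc a * g * z = ⁅z, g⁆⁻¹ * (⁅z, g⁆ * a) * g * z := by rw [inv_mul_cancel_left]
        _ = ⁅z, a⁆ * (a * ⁅z, g⁆) * g * z := by rw [hab, hag]
        _ = z * (a * g) := by simp only [commutatorElement_def]; group
    rw [← inv_mul_cancel_left a g]
    exact mul_mem (mem_sup_right (inv_mem ha)) (mem_sup_left (le_normalClosure hmem))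
  have htop := hcf _ (eq_top_of_sup_eq_top hcomm hsup)
  refine hzc (mem_centralizer_iff.2 fun a _ => mem_centralizer_singleton_iff.1 ?_)
  rw [htop]
  exact mem_top a

end MinimalNormal

section SelfCommutator

variable {G : Type*} [Group G] {A : Subgroup G}

theorem CentralPolycyclic.map {K : Subgroup G} (h : CentralPolycyclic A K) {Q : Type*} [Group Q]
    {f : G →* Q} (hf : Function.Surjective f) : CentralPolycyclic (A.map f) (K.map f) := by
  induction h with
  | base => exact .base
  | step z _ hz ih =>
    rw [Subgroup.map_sup, MonoidHom.map_zpowers]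
    refine ih.step (f z) fun q => ?_
    obtain ⟨g, rfl⟩ := hf q
    rw [← map_commutatorElement]
    exact mem_map_of_mem f (hz g)

theorem exists_lowerCentralSeries_le [A.Normal] (h : Group.IsNilpotent (G ⧸ A)) :
    ∃ n, (⊤ : Subgroup G).lowerCentralSeries n ≤ A := by
  obtain ⟨n, hn⟩ := Subgroup.nilpotent_iff_lowerCentralSeries.1 h
  refine ⟨n, ?_⟩
  rw [← map_top_of_surjective _ (QuotientGroup.mk'_surjective A), ← map_lowerCentralSeries,
    Subgroup.map_eq_bot_iff, QuotientGroup.ker_mk'] at hn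
  exact hn

theorem ContranormalFree.fg_of_commutator_eq [A.Normal] [IsMulCommutative A]
    (hcf : ContranormalFree G) (hcomm : ⁅A, (⊤ : Subgroup G)⁆ = A) (hfg : Group.FG (G ⧸ A)) :
    Group.FG G := by
  obtain ⟨s, hs⟩ := Group.fg_def.1 hfg
  choose f hf using QuotientGroup.mk'_surjective A
  have hmap : (closure (f '' s)).map (QuotientGroup.mk' A) = ⊤ := by
    rw [MonoidHom.map_closure, ← hs, Set.image_image]
    simp only [hf, Set.image_id']
  have hsup : closure (f '' s) ⊔ A = ⊤ := by
    have := comap_map_eq (QuotientGroup.mk' A) (closure (f '' s))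
    rwa [hmap, comap_top, QuotientGroup.ker_mk', eq_comm] at this
  have htop := hcf _ (eq_top_of_sup_eq_top hcomm
    (top_le_iff.1 (hsup.ge.trans (sup_le_sup_right le_normalClosure A))))
  exact Group.fg_iff.2 ⟨_, htop, s.finite_toSet.image f⟩

theorem exists_maximal_normal_not_le {s : Set G} (hs : s.Finite) (hne : normalClosure s ≠ ⊥) :
    ∃ L : Subgroup G, Maximal (fun N => N.Normal ∧ ¬ normalClosure s ≤ N) L := by
  suffices h : _ from (zorn_le_nonempty₀ {N : Subgroup G | N.Normal ∧ ¬ normalClosure s ≤ N} h ⊥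
    ⟨inferInstance, fun h => hne (le_bot_iff.1 h)⟩).imp fun _ => And.right
  intro c hc hchain y hy
  have hnormal := sSup_normal c fun H hH => (hc hH).1
  refine ⟨sSup c, ⟨hnormal, fun hle => ?_⟩, fun z hz => le_sSup hz⟩
  have hsub : (hs.toFinset : Set G) ⊆ ⋃ N ∈ c, (N : Set G) := by
    intro x hx
    have hx : x ∈ sSup c := hle (subset_normalClosure (hs.mem_toFinset.1 hx))
    simpa using (mem_sSup_of_directedOn ⟨y, hy⟩ hchain.directedOn).1 hx
  obtain ⟨N, hN, hsN⟩ := DirectedOn.exists_mem_subset_of_finset_subset_biUnion ⟨y, hy⟩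
    hchain.directedOn hsub
  rw [Set.Finite.coe_toFinset] at hsN
  have := (hc hN).1
  exact (hc hN).2 (normalClosure_le_normal hsN)

theorem ContranormalFree.eq_bot_of_commutator_eq [A.Normal] [IsMulCommutative A]
    (hcf : ContranormalFree G) (hfg : Group.FG (G ⧸ A)) (hnil : Group.IsNilpotent (G ⧸ A))
    (hcomm : ⁅A, (⊤ : Subgroup G)⁆ = A) : A = ⊥ := by
  obtain ⟨n, hn⟩ := exists_lowerCentralSeries_le hnil
  have hle : ∀ k, A ≤ (⊤ : Subgroup G).lowerCentralSeries k := by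
    intro k
    induction k with
    | zero => exact le_top
    | succ k ih =>
      rw [Subgroup.lowerCentralSeries_succ, ← hcomm]
      exact commutator_mono ih le_rfl
  obtain ⟨s, hs, hsn⟩ :=
    (hcf.fg_of_commutator_eq hcomm hfg).exists_finite_lowerCentralSeries_eq_normalClosure n
  have hA : A = normalClosure s := ((hle n).antisymm hn).trans hsn
  by_contra hne
  obtain ⟨L, ⟨hLn, hAL⟩, hmax⟩ := exists_maximal_normal_not_le hs (hA ▸ hne)
  rw [← hA] at hAL hmax
  have hsurj := QuotientGroup.mk'_surjective L
  have := Normal.map (H := A) inferInstance _ hsurj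
  have hbot : A.map (QuotientGroup.mk' L) = ⊥ := by
    refine (hcf.of_surjective hsurj).eq_bot_of_minimal ?_ ?_ fun N hN hNe => ?_
    · rw [← map_top_of_surjective _ hsurj]
      exact (centralPolycyclic_of_quotient A hfg hnil).map hsurj
    · rw [← map_top_of_surjective _ hsurj, ← map_commutator, hcomm]
    · rw [map_le_iff_le_comap]
      by_contra hN'
      have hLN : L ≤ N.comap (QuotientGroup.mk' L) := by
        simpa using ker_le_comap (QuotientGroup.mk' L) N
      have := hmax ⟨hN.comap _, hN'⟩ hLN
      refine hNe (le_bot_iff.1 ?_)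
      rw [← map_comap_eq_self_of_surjective hsurj N, le_bot_iff, Subgroup.map_eq_bot_iff]
      simpa using this
  rw [Subgroup.map_eq_bot_iff, QuotientGroup.ker_mk'] at hbot
  exact hAL hbot

theorem ContranormalFree.eq_of_sup_commutator_eq [A.Normal] [IsMulCommutative A]
    (hcf : ContranormalFree G) (hfg : Group.FG (G ⧸ A)) (hnil : Group.IsNilpotent (G ⧸ A))
    {C : Subgroup G} [C.Normal] (hC : C ≤ A) (h : C ⊔ ⁅A, (⊤ : Subgroup G)⁆ = A) : C = A := by
  have hsurj := QuotientGroup.mk'_surjective C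
  have := Normal.map (H := A) inferInstance _ hsurj
  let e := (QuotientGroup.quotientQuotientEquivQuotient C A hC).symm
  have hbot := (hcf.of_surjective hsurj).eq_bot_of_commutator_eq
    (A := A.map (QuotientGroup.mk' C)) (Group.fg_of_surjective (f := e.toMonoidHom) e.surjective)
    (Group.nilpotent_of_mulEquiv e) (by
      rw [← map_top_of_surjective _ hsurj, ← map_commutator]
      conv_rhs => rw [← h, Subgroup.map_sup]
      simp)
  rw [Subgroup.map_eq_bot_iff, QuotientGroup.ker_mk'] at hbot
  exact hC.antisymm hbot

end SelfCommutator

section ConjugationModule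

open scoped IsMulCommutative

variable {G : Type*} [Group G] (A : Subgroup G) [A.Normal] [IsMulCommutative A]

/-- An abelian normal subgroup as a module over the integral group ring, by conjugation. -/
noncomputable abbrev conjModule : Module (MonoidAlgebra ℤ G) (Additive A) :=
  letI := MulDistribMulAction.compHom A (MulAut.conjNormal (H := A))
  Module.compHom _
    (MonoidAlgebra.lift ℤ (Module.End ℤ (Additive A)) G
      (Representation.ofMulDistribMulAction G A)).toRingHom

attribute [local instance] conjModule

variable {A}

theorem coe_of_smul (g : G) (x : Additive A) :
    ((MonoidAlgebra.of ℤ G g • x).toMul : G) = g * (x.toMul : G) * g⁻¹ := by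
  let := MulDistribMulAction.compHom A (MulAut.conjNormal (H := A))
  change (((MonoidAlgebra.lift ℤ (Module.End ℤ (Additive A)) G
      (Representation.ofMulDistribMulAction G A)) (MonoidAlgebra.of ℤ G g) x).toMul : G) = _
  rw [MonoidAlgebra.lift_of]
  rfl

/-- The subgroup of `G` underlying a submodule of the abelian normal subgroup `A`. -/
noncomputable def submoduleSubgroup (U : Submodule (MonoidAlgebra ℤ G) (Additive A)) : Subgroup G :=
  U.toAddSubgroup.toSubgroup'.map A.subtype

theorem mem_submoduleSubgroup {U : Submodule (MonoidAlgebra ℤ G) (Additive A)} {g : G} :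
    g ∈ submoduleSubgroup U ↔ ∃ x ∈ U, (x.toMul : G) = g :=
  Iff.rfl

theorem submoduleSubgroup_le (U : Submodule (MonoidAlgebra ℤ G) (Additive A)) :
    submoduleSubgroup U ≤ A :=
  map_subtype_le _

instance normal_submoduleSubgroup (U : Submodule (MonoidAlgebra ℤ G) (Additive A)) :
    (submoduleSubgroup U).Normal := by
  refine ⟨?_⟩
  rintro _ ⟨x, hx, rfl⟩ g
  exact ⟨_, U.smul_mem (MonoidAlgebra.of ℤ G g) hx, coe_of_smul g x⟩

theorem commutator_submoduleSubgroup_le (U : Submodule (MonoidAlgebra ℤ G) (Additive A)) :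
    ⁅submoduleSubgroup U, (⊤ : Subgroup G)⁆ ≤
      submoduleSubgroup (MonoidAlgebra.augmentation U) := by
  rw [commutator_le]
  intro _ ha g _
  obtain ⟨x, hx, rfl⟩ := mem_submoduleSubgroup.1 ha
  refine mem_submoduleSubgroup.2 ⟨_, neg_mem (MonoidAlgebra.sub_mem_augmentation g hx), ?_⟩
  rw [neg_sub, toMul_sub, div_eq_mul_inv, Subgroup.coe_mul, Subgroup.coe_inv, coe_of_smul,
    commutatorElement_def]
  simp only [mul_inv_rev, inv_inv, mul_assoc]

theorem mem_commutator_of_mem_augmentation_top {x : Additive A}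
    (hx : x ∈ MonoidAlgebra.augmentation (⊤ : Submodule (MonoidAlgebra ℤ G) (Additive A))) :
    (x.toMul : G) ∈ ⁅A, (⊤ : Subgroup G)⁆ := by
  let N : AddSubgroup (Additive A) := (⁅A, (⊤ : Subgroup G)⁆.subgroupOf A).toAddSubgroup
  let C : Submodule (MonoidAlgebra ℤ G) (Additive A) :=
    { N with
      smul_mem' := fun r y hy => MonoidAlgebra.smul_mem_of_forall_of_smul_mem N
        (fun g z hz => by
          change ((MonoidAlgebra.of ℤ G g • z).toMul : G) ∈ ⁅A, (⊤ : Subgroup G)⁆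
          rw [coe_of_smul]
          exact Normal.conj_mem inferInstance _ hz g) r hy }
  have hC : MonoidAlgebra.augmentation (⊤ : Submodule (MonoidAlgebra ℤ G) (Additive A)) ≤ C := by
    rw [MonoidAlgebra.augmentation_le]
    intro g u _
    change ((MonoidAlgebra.of ℤ G g • u - u).toMul : G) ∈ ⁅A, (⊤ : Subgroup G)⁆
    rw [toMul_sub, div_eq_mul_inv, Subgroup.coe_mul, Subgroup.coe_inv, coe_of_smul,
      commutator_comm, ← commutatorElement_def]
    exact commutator_mem_commutator (mem_top g) u.toMul.2
  exact hC hx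

theorem ContranormalFree.exists_iterate_commutator_eq_bot (hcf : ContranormalFree G)
    (hfg : Group.FG (G ⧸ A)) (hnil : Group.IsNilpotent (G ⧸ A)) {s : Set G} (hs : s.Finite)
    (hsA : s ⊆ A) :
    ∃ n, (fun N : Subgroup G => ⁅N, (⊤ : Subgroup G)⁆)^[n] (normalClosure s) = ⊥ := by
  let U : Submodule (MonoidAlgebra ℤ G) (Additive A) :=
    Submodule.span _ {x | (x.toMul : G) ∈ s}
  have hU : U.FG := Submodule.fg_span
    (hs.preimage ((Subtype.val_injective.comp Additive.toMul.injective).injOn))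
  have htriv : ∀ a ∈ A, ∀ x : Additive A, MonoidAlgebra.of ℤ G a • x = x := by
    intro a ha x
    refine Additive.toMul.injective (Subtype.ext ?_)
    rw [coe_of_smul, setLike_mul_comm ha x.toMul.2, mul_inv_cancel_right]
  have hsup : ∀ C : Submodule (MonoidAlgebra ℤ G) (Additive A),
      C ⊔ MonoidAlgebra.augmentation ⊤ = ⊤ → C = ⊤ := by
    intro C hC
    have hCA : submoduleSubgroup C = A := by
      refine hcf.eq_of_sup_commutator_eq hfg hnil (submoduleSubgroup_le C)
        (le_antisymm (sup_le (submoduleSubgroup_le C) (commutator_le_left A ⊤)) fun a ha => ?_)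
      obtain ⟨c, hc, d, hd, hcd⟩ := Submodule.mem_sup.1
        (hC ▸ Submodule.mem_top : Additive.ofMul (⟨a, ha⟩ : A) ∈ _)
      have : (c.toMul : G) * (d.toMul : G) = a := congrArg (fun x => (x.toMul : G)) hcd
      rw [← this]
      exact mul_mem_sup (mem_submoduleSubgroup.2 ⟨c, hc, rfl⟩)
        (mem_commutator_of_mem_augmentation_top hd)
    refine eq_top_iff.2 fun x _ => ?_
    obtain ⟨y, hy, hyx⟩ := mem_submoduleSubgroup.1 (hCA.ge x.toMul.2)
    rwa [← Additive.toMul.injective (Subtype.ext hyx)]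
  obtain ⟨n, hn⟩ := MonoidAlgebra.exists_iterate_augmentation_eq_bot htriv
    (centralPolycyclic_of_quotient A hfg hnil) hsup hU
  refine ⟨n, le_bot_iff.1 ?_⟩
  have hle : ∀ k, (fun N : Subgroup G => ⁅N, (⊤ : Subgroup G)⁆)^[k] (normalClosure s) ≤
      submoduleSubgroup (MonoidAlgebra.augmentation^[k] U) := by
    intro k
    induction k with
    | zero =>
      exact normalClosure_le_normal fun x hx =>
        mem_submoduleSubgroup.2 ⟨.ofMul ⟨x, hsA hx⟩, Submodule.subset_span hx, rfl⟩
    | succ k ih =>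
      rw [Function.iterate_succ_apply', Function.iterate_succ_apply']
      exact (commutator_mono ih le_rfl).trans (commutator_submoduleSubgroup_le _)
  refine (hle n).trans ?_
  rw [hn]
  intro _ ha
  obtain ⟨x, hx, rfl⟩ := mem_submoduleSubgroup.1 ha
  rw [(Submodule.mem_bot _).1 hx]
  exact one_mem _

end ConjugationModule

/-- Let `A` be an abelian normal subgroup of `G` with `G/A` finitely generated nilpotent.
If `G` is contranormal-free, then `G` is locally nilpotent. -/
theorem locallyNilpotent_of_contranormalFree {G : Type*} [Group G] (A : Subgroup G)
    [A.Normal] (hab : ∀ x ∈ A, ∀ y ∈ A, x * y = y * x)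
    (hfg : Group.FG (G ⧸ A)) (hnil : Group.IsNilpotent (G ⧸ A))
    (hcf : ∀ H : Subgroup G, Subgroup.normalClosure (H : Set G) = ⊤ → H = ⊤) :
    ∀ S : Subgroup G, S.FG → Group.IsNilpotent S := by
  intro S hS
  have : IsMulCommutative A := ⟨⟨fun x y => Subtype.ext (hab x x.2 y y.2)⟩⟩
  obtain ⟨c, hc⟩ := exists_lowerCentralSeries_le hnil
  obtain ⟨s, hs, hsc⟩ := ((Group.fg_iff_subgroup_fg S).2
    hS).exists_finite_lowerCentralSeries_eq_normalClosure c
  have hmap := top_subtype_lowerCentralSeries S c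
  have hsA : S.subtype '' s ⊆ A := by
    rintro _ ⟨x, hx, rfl⟩
    refine hc (lowerCentralSeries_mono c le_top (hmap.le (mem_map_of_mem S.subtype ?_)))
    rw [hsc]
    exact subset_normalClosure hx
  obtain ⟨n, hn⟩ := ContranormalFree.exists_iterate_commutator_eq_bot hcf hfg hnil
    (hs.image S.subtype) hsA
  have hle : ∀ k, S.lowerCentralSeries (c + k) ≤
      (fun N : Subgroup G => ⁅N, (⊤ : Subgroup G)⁆)^[k] (normalClosure (S.subtype '' s)) := by
    intro k
    induction k with
    | zero =>
      rw [Nat.add_zero, Function.iterate_zero_apply, ← hmap, hsc, map_le_iff_le_comap]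
      exact normalClosure_le_normal fun x hx => subset_normalClosure (Set.mem_image_of_mem _ hx)
    | succ k ih =>
      rw [Function.iterate_succ_apply', ← Nat.add_assoc, Subgroup.lowerCentralSeries_succ]
      exact commutator_mono ih le_top
  exact (Subgroup.isNilpotent_iff_lowerCentralSeries S).2
    ⟨c + n, le_bot_iff.1 ((hle n).trans hn.le)⟩
end

section
/- Let G be a finitely generated soluble-by-finite group. If G is contranormal-free, then G is nilpotent. -/
/-- A finite subset of a `Λ`-span lies in the span over a finitely generated subalgebra. -/
theorem Submodule.exists_finset_subset_span_adjoin {R Λ M : Type*} [CommRing R] [CommRing Λ]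
    [Algebra R Λ] [AddCommGroup M] [Module Λ M] (E : Set M) {V : Set M} (hV : V.Finite)
    (hVE : V ⊆ Submodule.span Λ E) :
    ∃ C : Finset Λ, V ⊆ Submodule.span (Algebra.adjoin R (C : Set Λ)) E := by
  classical
  have mono : ∀ C D : Finset Λ, C ⊆ D → ∀ v ∈ Submodule.span (Algebra.adjoin R (C : Set Λ)) E,
      v ∈ Submodule.span (Algebra.adjoin R (D : Set Λ)) E := by
    intro C D hCD v hv
    induction hv using Submodule.span_induction with
    | mem x hx => exact Submodule.subset_span hx
    | zero => exact Submodule.zero_mem _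
    | add x y _ _ hx hy => exact Submodule.add_mem _ hx hy
    | smul c x _ hx =>
      exact Submodule.smul_mem _
        (⟨c, Algebra.adjoin_mono (Finset.coe_subset.2 hCD) c.2⟩ :
          Algebra.adjoin R (D : Set Λ)) hx
  have single : ∀ v ∈ Submodule.span Λ E,
      ∃ C : Finset Λ, v ∈ Submodule.span (Algebra.adjoin R (C : Set Λ)) E := by
    intro v hv
    induction hv using Submodule.span_induction with
    | mem x hx => exact ⟨∅, Submodule.subset_span hx⟩
    | zero => exact ⟨∅, Submodule.zero_mem _⟩
    | add x y _ _ hx hy =>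
      obtain ⟨C, hC⟩ := hx
      obtain ⟨D, hD⟩ := hy
      exact ⟨C ∪ D, Submodule.add_mem _ (mono _ _ Finset.subset_union_left _ hC)
        (mono _ _ Finset.subset_union_right _ hD)⟩
    | smul c x _ hx =>
      obtain ⟨C, hC⟩ := hx
      exact ⟨insert c C, Submodule.smul_mem _
        (⟨c, Algebra.subset_adjoin (by simp)⟩ :
          Algebra.adjoin R ((insert c C : Finset Λ) : Set Λ))
        (mono _ _ (Finset.subset_insert c C) _ hC)⟩
  induction V, hV using Set.Finite.induction_on with
  | empty => exact ⟨∅, by simp⟩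
  | @insert v V _ _ ih =>
    obtain ⟨C, hC⟩ := ih ((Set.subset_insert _ _).trans hVE)
    obtain ⟨D, hD⟩ := single v (hVE (Set.mem_insert _ _))
    refine ⟨C ∪ D, Set.insert_subset (mono _ _ Finset.subset_union_right _ hD) fun x hx => ?_⟩
    exact mono _ _ Finset.subset_union_left _ (hC hx)

/-- In a finitely generated algebra over a Jacobson ring, a proper ideal whose radical misses `w`
lies in a maximal ideal that contains some `1 + w * f` with `f` in the base ring. -/
theorem Ideal.exists_isMaximal_one_add_mul_mem {R k : Type*} [CommRing R] [IsJacobsonRing R]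
    [CommRing k] [Algebra R k] [Algebra.FiniteType R k] (J : Ideal k) (w : R)
    (hw : ∀ n : ℕ, algebraMap R k (w ^ n) ∉ J) :
    ∃ m : Ideal k, m.IsMaximal ∧ J ≤ m ∧ ∃ f : R, algebraMap R k (1 + w * f) ∈ m := by
  have : IsJacobsonRing k := isJacobsonRing_of_finiteType (A := R)
  have hrad : algebraMap R k w ∉ J.radical := by
    rintro ⟨n, hn⟩
    exact hw n (by simpa using hn)
  rw [Ideal.radical_eq_jacobson, Ideal.jacobson, Submodule.mem_sInf] at hrad
  push Not at hrad
  obtain ⟨m, ⟨hJm, hm⟩, hwm⟩ := hrad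
  refine ⟨m, hm, hJm, ?_⟩
  let _ : Field (k ⧸ m) := Ideal.Quotient.field m
  have : Module.Finite R (k ⧸ m) := finite_of_finite_type_of_isJacobsonRing R (k ⧸ m)
  have hmax : ((⊥ : Ideal (k ⧸ m)).comap (algebraMap R (k ⧸ m))).IsMaximal :=
    Ideal.isMaximal_comap_of_isIntegral_of_isMaximal _
  have hmem : ∀ r : R, r ∈ (⊥ : Ideal (k ⧸ m)).comap (algebraMap R (k ⧸ m)) ↔
      algebraMap R k r ∈ m := by
    intro r
    rw [Ideal.mem_comap, Ideal.mem_bot, IsScalarTower.algebraMap_apply R k (k ⧸ m),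
      Ideal.Quotient.algebraMap_eq, Ideal.Quotient.eq_zero_iff_mem]
  obtain ⟨y, hy⟩ := hmax.exists_inv (mt (hmem w).1 hwm)
  obtain ⟨i, hi, hyi⟩ := hy
  refine ⟨-y, (hmem _).1 ?_⟩
  rwa [show 1 + w * -y = i by rw [← hyi]; ring]

/-- Let `T` be the `R`-module generated by `a` under finitely many `Λ`-endomorphisms of a finitely
generated `Λ`-module. If no power of `w` kills `a`, then some `1 + w * f` does not act
surjectively on `T`. -/
theorem Module.false_of_forall_one_add_mul_divisible {R Λ M : Type*} [CommRing R]
    [IsNoetherianRing R] [IsJacobsonRing R] [CommRing Λ] [Algebra R Λ] [AddCommGroup M]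
    [Module R M] [Module Λ M] [IsScalarTower R Λ M] {E : Set M} (hE : E.Finite)
    {X : Set (M →ₗ[Λ] M)} (hX : X.Finite)
    (hXE : ∀ x ∈ X, ∀ e ∈ E, x e ∈ Submodule.span Λ E) {a : M} (ha : a ∈ Submodule.span Λ E)
    {w : R} (hw : ∀ n : ℕ, w ^ n • a ≠ 0) {T : Submodule R M} (haT : a ∈ T)
    (hT : ∀ S : Submodule R M, a ∈ S → (∀ x ∈ X, ∀ s ∈ S, x s ∈ S) → T ≤ S)
    (hdiv : ∀ f : R, ∀ t ∈ T, ∃ t' ∈ T, t = (1 + w * f) • t') : False := by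
  obtain ⟨C, hC⟩ := Submodule.exists_finset_subset_span_adjoin (R := R) E
    (V := insert a (Set.image2 (fun (x : M →ₗ[Λ] M) e => x e) X E))
    ((hX.image2 _ hE).insert _) (by
      rintro v (rfl | ⟨x, hx, e, he, rfl⟩)
      exacts [ha, hXE x hx e he])
  let k := Algebra.adjoin R (C : Set Λ)
  have : Algebra.FiniteType R k := (Subalgebra.fg_iff_finiteType _).1 ⟨C, rfl⟩
  have : IsNoetherianRing k := Algebra.FiniteType.isNoetherianRing R k
  let L : Submodule k M := Submodule.span k E
  have : Module.Finite k L := Module.Finite.span_of_finite k hE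
  have hkM : ∀ (r : R) (v : M), algebraMap R k r • v = r • v := fun r v =>
    algebraMap_smul Λ r v
  have hTL : ∀ t ∈ T, t ∈ L := by
    let S : Submodule R M :=
      { L.toAddSubmonoid with
        smul_mem' := fun r v hv => by
          rw [← hkM]
          exact L.smul_mem _ hv }
    refine hT S (hC (Set.mem_insert _ _)) fun x hx s hs => ?_
    change x s ∈ L
    replace hs : s ∈ L := hs
    induction hs using Submodule.span_induction with
    | mem e he => exact hC (Set.mem_insert_of_mem _ ⟨x, hx, e, he, rfl⟩)
    | zero => rw [map_zero]; exact L.zero_mem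
    | add u v _ _ hu hv => rw [map_add]; exact L.add_mem hu hv
    | smul c v _ hv =>
      rw [show x (c • v) = c • x v from x.map_smul (c : Λ) v]
      exact L.smul_mem c hv
  obtain ⟨m, hm, hJm, f, hf⟩ := Ideal.exists_isMaximal_one_add_mul_mem
    (Ideal.torsionOf k M a) w (fun n hn => hw n (by
      rwa [Ideal.mem_torsionOf_iff, hkM] at hn))
  have hpow : ∀ n : ℕ, ∀ t (ht : t ∈ T), (⟨t, hTL t ht⟩ : L) ∈ (m ^ n • ⊤ : Submodule k L) := by
    intro n
    induction n with
    | zero => simp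
    | succ n ih =>
      intro t ht
      obtain ⟨t', ht', rfl⟩ := hdiv f t ht
      rw [pow_succ', mul_smul]
      have := Submodule.smul_mem_smul hf (ih t' ht')
      convert this using 1
      exact Subtype.ext (hkM _ _).symm
  obtain ⟨r, hr⟩ := (Ideal.mem_iInf_smul_pow_eq_bot_iff m (⟨a, hTL a haT⟩ : L)).1
    (Submodule.mem_iInf _ |>.2 fun n => hpow n a haT)
  have h1 : (1 - r : k) ∈ Ideal.torsionOf k M a := by
    rw [Ideal.mem_torsionOf_iff, sub_smul, one_smul, sub_eq_zero]
    exact (congrArg Subtype.val hr).symm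
  exact hm.ne_top ((Ideal.eq_top_iff_one _).2 (by simpa using add_mem (hJm h1) r.2))

section AugmentationSeries

variable {R A G : Type*} [CommRing R] [AddCommGroup A] [Module R A] [Group G]

/-- The series `B ≥ [B, G] ≥ [B, G, G] ≥ …` of a submodule `B` under a linear action of `G`. -/
def augSeries (ρ : G →* Module.End R A) (B : Submodule R A) : ℕ → Submodule R A
  | 0 => B
  | n + 1 => Submodule.span R {x | ∃ g, ∃ b ∈ augSeries ρ B n, ρ g b - b = x}

variable (ρ : G →* Module.End R A)

theorem sub_mem_augSeries_succ {B : Submodule R A} {n : ℕ} {b : A} (hb : b ∈ augSeries ρ B n)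
    (g : G) : ρ g b - b ∈ augSeries ρ B (n + 1) :=
  Submodule.subset_span ⟨g, b, hb, rfl⟩

theorem augSeries_mono {B C : Submodule R A} (h : B ≤ C) (n : ℕ) :
    augSeries ρ B n ≤ augSeries ρ C n := by
  induction n with
  | zero => exact h
  | succ n ih =>
    refine Submodule.span_mono ?_
    rintro x ⟨g, b, hb, rfl⟩
    exact ⟨g, b, ih hb, rfl⟩

theorem augSeries_le {ρ : G →* Module.End R A} (C : ℕ → Submodule R A)
    (hC : ∀ n, ∀ b ∈ C n, ∀ g, ρ g b - b ∈ C (n + 1)) (n : ℕ) :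
    augSeries ρ (C 0) n ≤ C n := by
  induction n with
  | zero => exact le_rfl
  | succ n ih =>
    refine Submodule.span_le.2 ?_
    rintro x ⟨g, b, hb, rfl⟩
    exact hC n b (ih hb) g

theorem apply_mem_span_orbit {a b : A} (hb : b ∈ Submodule.span R (Set.range fun g => ρ g a))
    (g : G) : ρ g b ∈ Submodule.span R (Set.range fun g => ρ g a) := by
  have hle : Submodule.span R (Set.range fun g => ρ g a) ≤
      (Submodule.span R (Set.range fun g => ρ g a)).comap (ρ g) := by
    refine Submodule.span_le.2 ?_
    rintro _ ⟨h, rfl⟩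
    exact Submodule.subset_span ⟨g * h, by simp⟩
  exact hle hb

/-- Modulo the next term, each term of the series of a cyclic submodule is finitely generated. -/
theorem exists_finite_augSeries_le_span_sup [hG : Group.FG G] (a : A) (n : ℕ) :
    ∃ F : Set A, F.Finite ∧
      F ⊆ augSeries ρ (Submodule.span R (Set.range fun g => ρ g a)) n ∧
      augSeries ρ (Submodule.span R (Set.range fun g => ρ g a)) n ≤ Submodule.span R F ⊔
        augSeries ρ (Submodule.span R (Set.range fun g => ρ g a)) (n + 1) := by
  set B := Submodule.span R (Set.range fun g => ρ g a) with hB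
  induction n with
  | zero =>
    have haB : a ∈ B := Submodule.subset_span ⟨1, by simp⟩
    refine ⟨{a}, Set.finite_singleton a, by simpa [augSeries] using haB, ?_⟩
    refine Submodule.span_le.2 ?_
    rintro _ ⟨g, rfl⟩
    have h : ρ g a = a + (ρ g a - a) := by abel
    change ρ g a ∈ _
    rw [h]
    exact Submodule.add_mem_sup (Submodule.mem_span_singleton_self a)
      (sub_mem_augSeries_succ ρ (n := 0) haB g)
  | succ n ih =>
    obtain ⟨F, hF, hFn, hspan⟩ := ih
    obtain ⟨X, hX, hXfin⟩ := Group.fg_iff.1 hG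
    refine ⟨Set.image2 (fun x f => ρ x f - f) X F, hXfin.image2 _ hF, ?_, ?_⟩
    · rintro _ ⟨x, -, f, hf, rfl⟩
      exact sub_mem_augSeries_succ ρ (hFn hf) x
    set U := Submodule.span R (Set.image2 (fun x f => ρ x f - f) X F) ⊔
      augSeries ρ B (n + 1 + 1) with hU
    have hdeep : ∀ g, ∀ b ∈ augSeries ρ B (n + 1), ρ g b - b ∈ U := fun g b hb =>
      Submodule.mem_sup_right (sub_mem_augSeries_succ ρ hb g)
    have hgen : ∀ f ∈ F, ∀ g, ρ g f - f ∈ U := by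
      intro f hf g
      have hg : g ∈ Subgroup.closure X := hX ▸ Subgroup.mem_top g
      induction hg using Subgroup.closure_induction with
      | mem x hx => exact Submodule.mem_sup_left (Submodule.subset_span ⟨x, hx, f, hf, rfl⟩)
      | one => simp
      | mul x y _ _ hx hy =>
        have h1 := hdeep x _ (sub_mem_augSeries_succ ρ (hFn hf) y)
        have h : ρ (x * y) f - f =
            (ρ x (ρ y f - f) - (ρ y f - f)) + (ρ x f - f) + (ρ y f - f) := by
          rw [map_mul, Module.End.mul_apply, map_sub]
          abel
        rw [h]
        exact U.add_mem (U.add_mem h1 hx) hy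
      | inv x _ hx =>
        have h1 := hdeep x _ (sub_mem_augSeries_succ ρ (hFn hf) x⁻¹)
        have hxx : ρ x (ρ x⁻¹ f) = f := by
          rw [← Module.End.mul_apply, ← map_mul]
          simp
        have h : ρ x⁻¹ f - f = -(ρ x (ρ x⁻¹ f - f) - (ρ x⁻¹ f - f)) - (ρ x f - f) := by
          rw [map_sub, hxx]
          abel
        rw [h]
        exact U.sub_mem (U.neg_mem h1) hx
    refine Submodule.span_le.2 ?_
    rintro _ ⟨g, b, hb, rfl⟩
    obtain ⟨u, hu, v, hv, rfl⟩ := Submodule.mem_sup.1 (hspan hb)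
    have h : ρ g (u + v) - (u + v) = (ρ g u - u) + (ρ g v - v) := by
      rw [map_add]
      abel
    rw [h]
    refine U.add_mem ?_ (hdeep g v hv)
    have hle : Submodule.span R F ≤ U.comap (ρ g - 1) :=
      Submodule.span_le.2 fun f hf => by simpa using hgen f hf g
    simpa using hle hu

theorem exists_finite_le_span_sup_augSeries [Group.FG G] (a : A) (n : ℕ) :
    ∃ F : Set A, F.Finite ∧ F ⊆ Submodule.span R (Set.range fun g => ρ g a) ∧
      Submodule.span R (Set.range fun g => ρ g a) ≤ Submodule.span R F ⊔
        augSeries ρ (Submodule.span R (Set.range fun g => ρ g a)) n := by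
  set B := Submodule.span R (Set.range fun g => ρ g a) with hB
  have hstable : ∀ b ∈ B, ∀ g, ρ g b ∈ B := fun b hb g => apply_mem_span_orbit ρ hb g
  have hle : ∀ n, augSeries ρ B n ≤ B :=
    augSeries_le (fun _ => B) fun _ b hb g => B.sub_mem (hstable b hb g) hb
  induction n with
  | zero => exact ⟨∅, Set.finite_empty, by simp, le_sup_right⟩
  | succ n ih =>
    obtain ⟨F, hF, hFB, hspan⟩ := ih
    obtain ⟨F', hF', hFB', hspan'⟩ := exists_finite_augSeries_le_span_sup ρ a n
    refine ⟨F ∪ F', hF.union hF', Set.union_subset hFB (hFB'.trans (hle n)), ?_⟩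
    rw [Submodule.span_union, sup_assoc]
    exact hspan.trans (sup_le_sup_left hspan' _)

/-- A scalar with nonzero action acts injectively if `A` is nilpotent modulo each nonzero
invariant submodule and has no nonzero fixed points. -/
theorem smul_injective_of_augSeries_le
    (hnil : ∀ S : Submodule R A, S ≠ ⊥ → (∀ g, ∀ s ∈ S, ρ g s ∈ S) → ∃ n, augSeries ρ ⊤ n ≤ S)
    (hfix : ∀ b, (∀ g, ρ g b = b) → b = 0) {w : R} (hw : ∃ a : A, w • a ≠ 0) {b : A}
    (hb : w • b = 0) : b = 0 := by
  classical
  set K := LinearMap.ker (LinearMap.lsmul R A w) with hK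
  have memK : ∀ x, x ∈ K ↔ w • x = 0 := fun x => by simp [hK]
  by_contra hb0
  have hKn : ∃ n, augSeries ρ ⊤ n ≤ K := by
    refine hnil K ((Submodule.ne_bot_iff _).2 ⟨b, (memK b).2 hb, hb0⟩) fun g s hs => ?_
    rw [memK] at hs ⊢
    rw [← map_smul, hs, map_zero]
  obtain ⟨n, hn, hmin⟩ : ∃ n, augSeries ρ ⊤ n ≤ K ∧ ∀ m < n, ¬ augSeries ρ ⊤ m ≤ K :=
    ⟨Nat.find hKn, Nat.find_spec hKn, fun m hm => Nat.find_min hKn hm⟩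
  cases n with
  | zero =>
    obtain ⟨a, ha⟩ := hw
    exact ha ((memK a).1 (hn (Submodule.mem_top : a ∈ (⊤ : Submodule R A))))
  | succ n =>
    obtain ⟨c, hc, hcK⟩ := SetLike.not_le_iff_exists.1 (hmin n n.lt_succ_self)
    refine hcK ((memK c).2 (hfix _ fun g => ?_))
    have := (memK _).1 (hn (sub_mem_augSeries_succ ρ hc g))
    rwa [smul_sub, ← map_smul, sub_eq_zero] at this

theorem pow_smul_mem_augSeries {w : R} {z : G} (hz : ∀ b, w • b = ρ z b - b) (B : Submodule R A)
    (n : ℕ) : ∀ b ∈ B, w ^ n • b ∈ augSeries ρ B n := by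
  induction n with
  | zero =>
    intro b hb
    simpa [augSeries] using hb
  | succ n ih =>
    intro b hb
    rw [pow_succ', mul_smul, hz]
    exact sub_mem_augSeries_succ ρ (ih b hb) z

/-- If `w` acts injectively as `z - 1` on `A`, and `A` is nilpotent modulo each nonzero invariant
submodule, then `w` acts surjectively on each cyclic submodule. The proof embeds the cyclic
submodule `B` into the product of the quotients `A ⧸ w ^ n • B`, where its image lies in a finitely
generated module over the ring `ℕ → R`. -/
theorem span_orbit_le_map_smul [IsNoetherianRing R] [IsJacobsonRing R] [hG : Group.FG G]
    (hnil : ∀ S : Submodule R A, S ≠ ⊥ → (∀ g, ∀ s ∈ S, ρ g s ∈ S) → ∃ n, augSeries ρ ⊤ n ≤ S)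
    {w : R} {z : G} (hz : ∀ b, w • b = ρ z b - b) (hinj : ∀ b : A, w • b = 0 → b = 0)
    {a : A} (ha : a ≠ 0) :
    Submodule.span R (Set.range fun g => ρ g a) ≤
      (Submodule.span R (Set.range fun g => ρ g a)).map (LinearMap.lsmul R A w) := by
  set B := Submodule.span R (Set.range fun g => ρ g a) with hB
  by_contra hcon
  have haB : a ∈ B := Submodule.subset_span ⟨1, by simp⟩
  have hstable : ∀ b ∈ B, ∀ g, ρ g b ∈ B := fun b hb g => apply_mem_span_orbit ρ hb g
  have hmem : ∀ (r : R) (x : A), x ∈ B.map (LinearMap.lsmul R A r) ↔ ∃ b ∈ B, r • b = x := by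
    intro r x
    simp
  have hmapstable : ∀ (r : R) (g : G), ∀ s ∈ B.map (LinearMap.lsmul R A r),
      ρ g s ∈ B.map (LinearMap.lsmul R A r) := by
    intro r g s hs
    obtain ⟨b, hb, rfl⟩ := (hmem r s).1 hs
    exact (hmem r _).2 ⟨ρ g b, hstable b hb g, by rw [map_smul]⟩
  have hinjpow : ∀ (n : ℕ) (b : A), w ^ n • b = 0 → b = 0 := by
    intro n
    induction n with
    | zero => intro b hb; simpa using hb
    | succ n ih =>
      intro b hb
      rw [pow_succ', mul_smul] at hb
      exact ih b (hinj _ hb)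
  have hwa : w • a ≠ 0 := fun h => ha (hinj a h)
  have hdiv : ∀ f : R, ∀ b ∈ B, ∃ b' ∈ B, b = (1 + w * f) • b' := by
    intro f b hb
    set S := B.map (LinearMap.lsmul R A (1 + w * f)) with hS
    by_cases hS0 : S = ⊥
    · refine absurd (fun x hx => ?_) hcon
      have hx0 : (1 + w * f) • x = 0 := by
        have : (1 + w * f) • x ∈ S := (hmem _ _).2 ⟨x, hx, rfl⟩
        rwa [hS0, Submodule.mem_bot] at this
      refine (hmem _ _).2 ⟨-(f • x), B.neg_mem (B.smul_mem f hx), ?_⟩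
      rw [add_smul, one_smul, mul_smul] at hx0
      rw [smul_neg, eq_comm]
      exact eq_neg_of_add_eq_zero_left hx0
    · obtain ⟨n, hn⟩ := hnil S hS0 (hmapstable _)
      have h1 : (-(w * f)) ^ n • b ∈ S := by
        rw [neg_eq_neg_one_mul, mul_pow, mul_pow, mul_comm (w ^ n), ← mul_assoc, mul_smul]
        exact S.smul_mem _ (hn (pow_smul_mem_augSeries ρ hz ⊤ n b Submodule.mem_top))
      obtain ⟨q, hq⟩ := sub_one_dvd_pow_sub_one (-(w * f)) n
      have h2 : b = (-(w * f)) ^ n • b + (1 + w * f) • (q • b) := by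
        rw [smul_smul, ← add_smul, show (-(w * f)) ^ n + (1 + w * f) * q = 1 by
          linear_combination hq, one_smul]
      have h3 : b ∈ S := by
        rw [h2]
        exact S.add_mem h1 ((hmem _ _).2 ⟨q • b, B.smul_mem q hb, rfl⟩)
      obtain ⟨b', hb', h⟩ := (hmem _ _).1 h3
      exact ⟨b', hb', h.symm⟩
  have hsep : ∀ b : A, (∀ n : ℕ, b ∈ B.map (LinearMap.lsmul R A (w ^ n))) → b = 0 := by
    intro b hb
    by_contra hb0
    obtain ⟨n, hn⟩ := hnil (⨅ n : ℕ, B.map (LinearMap.lsmul R A (w ^ n)))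
      ((Submodule.ne_bot_iff _).2 ⟨b, Submodule.mem_iInf _ |>.2 hb, hb0⟩)
      fun g s hs => Submodule.mem_iInf _ |>.2 fun n =>
        hmapstable _ g s (Submodule.mem_iInf _ |>.1 hs n)
    refine hcon fun x hx => ?_
    have h1 := Submodule.mem_iInf _ |>.1
      (hn (pow_smul_mem_augSeries ρ hz ⊤ n x Submodule.mem_top)) (n + 1)
    obtain ⟨y, hy, hxy⟩ := (hmem _ _).1 h1
    refine (hmem _ _).2 ⟨y, hy, ?_⟩
    rw [pow_succ, mul_smul, ← sub_eq_zero, ← smul_sub] at hxy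
    exact sub_eq_zero.1 (hinjpow n _ hxy)
  obtain ⟨F, hF, hFB, hspan⟩ : ∃ F : Set A, F.Finite ∧ F ⊆ B ∧
      B ≤ Submodule.span R F ⊔ B.map (LinearMap.lsmul R A w) := by
    obtain ⟨n, hn⟩ := hnil (B.map (LinearMap.lsmul R A w))
      ((Submodule.ne_bot_iff _).2 ⟨w • a, (hmem _ _).2 ⟨a, haB, rfl⟩, hwa⟩) (hmapstable _)
    obtain ⟨F, hF, hFB, hspan⟩ := exists_finite_le_span_sup_augSeries ρ a n
    exact ⟨F, hF, hFB, hspan.trans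
      (sup_le_sup_left ((augSeries_mono ρ le_top n).trans hn) _)⟩
  have hspanpow : ∀ n : ℕ, B ≤ Submodule.span R F ⊔ B.map (LinearMap.lsmul R A (w ^ n)) := by
    intro n
    induction n with
    | zero => exact fun x hx => Submodule.mem_sup_right ((hmem _ _).2 ⟨x, hx, by simp⟩)
    | succ n ih =>
      intro x hx
      obtain ⟨u, hu, v, hv, rfl⟩ := Submodule.mem_sup.1 (ih hx)
      obtain ⟨y, hy, rfl⟩ := (hmem _ _).1 hv
      obtain ⟨u', hu', v', hv', rfl⟩ := Submodule.mem_sup.1 (hspan hy)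
      obtain ⟨y', hy', rfl⟩ := (hmem _ _).1 hv'
      rw [smul_add, ← add_assoc, smul_smul, ← pow_succ]
      exact Submodule.add_mem_sup (Submodule.add_mem _ hu (Submodule.smul_mem _ _ hu'))
        ((hmem _ _).2 ⟨y', hy', rfl⟩)
  let Q : ℕ → Submodule R A := fun n => B.map (LinearMap.lsmul R A (w ^ n))
  let δ : A →ₗ[R] (∀ n, A ⧸ Q n) := LinearMap.pi fun n => (Q n).mkQ
  have : IsScalarTower R (ℕ → R) (∀ n, A ⧸ Q n) :=
    ⟨fun r l m => funext fun n => smul_assoc r (l n) (m n)⟩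
  let σ : G → ((∀ n, A ⧸ Q n) →ₗ[ℕ → R] (∀ n, A ⧸ Q n)) := fun g =>
    { toFun := fun m n => (Q n).mapQ (Q n) (ρ g) (fun s hs => hmapstable _ g s hs) (m n)
      map_add' := fun m m' => funext fun n => map_add _ _ _
      map_smul' := fun l m => funext fun n => map_smul _ (l n) (m n) }
  have hσδ : ∀ g x, σ g (δ x) = δ (ρ g x) := fun g x => rfl
  have hδspan : ∀ b ∈ B, δ b ∈ Submodule.span (ℕ → R) (δ '' F) := by
    intro b hb
    obtain ⟨s, rfl⟩ := hF.exists_finset_coe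
    have hc : ∀ n, ∃ c : A → R, (Q n).mkQ b = ∑ f ∈ s, c f • (Q n).mkQ f := by
      intro n
      obtain ⟨u, hu, v, hv, rfl⟩ := Submodule.mem_sup.1 (hspanpow n hb)
      obtain ⟨c, -, rfl⟩ := Submodule.mem_span_finset.1 hu
      refine ⟨c, ?_⟩
      have hv0 : (Q n).mkQ v = 0 := (Submodule.Quotient.mk_eq_zero _).2 hv
      rw [map_add, hv0, add_zero, map_sum]
      simp only [map_smul]
    choose c hc using hc
    have hsum : δ b = ∑ f ∈ s, (fun n => c n f) • δ f := by
      funext n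
      rw [Finset.sum_apply]
      exact hc n
    rw [hsum]
    exact Submodule.sum_mem _ fun f hf =>
      Submodule.smul_mem _ _ (Submodule.subset_span ⟨f, hf, rfl⟩)
  have hδ0 : ∀ b, δ b = 0 → b = 0 := fun b hb => hsep b fun n =>
    (Submodule.Quotient.mk_eq_zero _).1 (congrFun hb n)
  obtain ⟨X, hX, hXfin⟩ := Group.fg_iff.1 hG
  refine Module.false_of_forall_one_add_mul_divisible (R := R) (Λ := ℕ → R) (w := w)
    (E := δ '' F) (hF.image _) (X := σ '' (X ∪ X⁻¹)) ((hXfin.union hXfin.inv).image _) ?_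
    (hδspan a haB) (fun n hn => ?_) (T := B.map δ) ⟨a, haB, rfl⟩ (fun S haS hS => ?_) ?_
  · rintro _ ⟨g, -, rfl⟩ _ ⟨f, hf, rfl⟩
    rw [hσδ]
    exact hδspan _ (hstable f (hFB hf) g)
  · rw [← map_smul] at hn
    exact ha (hinjpow n a (hδ0 _ hn))
  · rw [Submodule.map_le_iff_le_comap]
    refine Submodule.span_le.2 ?_
    rintro _ ⟨g, rfl⟩
    change δ (ρ g a) ∈ S
    have hg : g ∈ Subgroup.closure X := hX ▸ Subgroup.mem_top g
    induction hg using Subgroup.closure_induction_left with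
    | one => simpa using haS
    | mul_left x hx y _ ih =>
      rw [map_mul, Module.End.mul_apply, ← hσδ]
      exact hS _ ⟨x, Or.inl hx, rfl⟩ _ ih
    | inv_mul_cancel x hx y _ ih =>
      rw [map_mul, Module.End.mul_apply, ← hσδ]
      exact hS _ ⟨x⁻¹, Or.inr (Set.inv_mem_inv.2 hx), rfl⟩ _ ih
  · rintro f _ ⟨b, hb, rfl⟩
    obtain ⟨b', hb', h⟩ := hdiv f b hb
    exact ⟨δ b', ⟨b', hb', rfl⟩, by rw [← map_smul, ← h]⟩

/-- Let `A` be nilpotent modulo each nonzero invariant submodule and without nonzero fixed points.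
If `z - 1` acts as a scalar and not as zero, then it is surjective. -/
theorem smul_surjective_of_augSeries_le [IsNoetherianRing R] [IsJacobsonRing R] [Group.FG G]
    (hnil : ∀ S : Submodule R A, S ≠ ⊥ → (∀ g, ∀ s ∈ S, ρ g s ∈ S) → ∃ n, augSeries ρ ⊤ n ≤ S)
    (hfix : ∀ b, (∀ g, ρ g b = b) → b = 0)
    {w : R} {z : G} (hz : ∀ b, w • b = ρ z b - b) (hw : ∃ a : A, w • a ≠ 0) (c : A) :
    ∃ b : A, w • b = c := by
  have hinj : ∀ b : A, w • b = 0 → b = 0 := fun b hb =>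
    smul_injective_of_augSeries_le ρ hnil hfix hw hb
  obtain ⟨a, ha⟩ := hw
  have ha0 : a ≠ 0 := fun h => ha (by rw [h, smul_zero])
  have hB := span_orbit_le_map_smul ρ hnil hz hinj ha0
  set B := Submodule.span R (Set.range fun g => ρ g a) with hBdef
  obtain ⟨n, hn⟩ := hnil B
    ((Submodule.ne_bot_iff _).2 ⟨a, Submodule.subset_span ⟨1, by simp⟩, ha0⟩)
    fun g b hb => apply_mem_span_orbit ρ hb g
  have hdescend : ∀ (n : ℕ) (x : A), w ^ n • x ∈ B → x ∈ B := by
    intro n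
    induction n with
    | zero => intro x hx; simpa using hx
    | succ n ih =>
      intro x hx
      rw [pow_succ', mul_smul] at hx
      obtain ⟨y, hy, hxy⟩ := hB hx
      rw [LinearMap.lsmul_apply, ← sub_eq_zero, ← smul_sub] at hxy
      exact ih x (sub_eq_zero.1 (hinj _ hxy) ▸ hy)
  obtain ⟨b, -, hb⟩ := hB (hdescend n c (hn (pow_smul_mem_augSeries ρ hz ⊤ n c Submodule.mem_top)))
  exact ⟨b, hb⟩

end AugmentationSeries

section LinearReduction

open Polynomial

theorem Commute.aeval_right {V : Type*} [AddCommGroup V] {f w : Module.End ℤ V} (h : Commute f w)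
    (p : ℤ[X]) : Commute f (aeval w p) := by
  induction p using Polynomial.induction_on' with
  | add p q hp hq => rw [map_add]; exact hp.add_right hq
  | monomial n c =>
    rw [aeval_monomial]
    exact Commute.mul_right (Algebra.commutes c f).symm (h.pow_right n)

instance Int.isJacobsonRing_s13 : IsJacobsonRing ℤ := by
  refine isJacobsonRing_iff_prime_eq.2 fun P hP => ?_
  rcases eq_or_ne P ⊥ with rfl | hne
  · refine (Submodule.eq_bot_iff _).2 fun x hx => ?_
    rcases Int.isUnit_iff.1 (Ideal.mem_jacobson_bot.1 hx x) with h | h <;> nlinarith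
  · have := hP.isMaximal hne
    exact Ideal.jacobson_eq_self_of_isMaximal

/-- Let `z` act centrally and nontrivially on an abelian group without nonzero `G`-fixed points
which is `G`-nilpotent modulo each nonzero invariant subgroup. Then `z - 1` is surjective. -/
theorem sub_one_surjective_of_descending_series {V G : Type*} [AddCommGroup V] [Group G]
    [Group.FG G] (ρ : G →* Module.End ℤ V) {z : G} (hcomm : ∀ g, Commute (ρ g) (ρ z))
    (C : ℕ → AddSubgroup V) (hC0 : C 0 = ⊤) (hanti : Antitone C)
    (hC : ∀ n, ∀ b ∈ C n, ∀ g, ρ g b - b ∈ C (n + 1))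
    (hnil : ∀ S : AddSubgroup V, S ≠ ⊥ → (∀ g, ∀ s ∈ S, ρ g s ∈ S) → ∃ n, C n ≤ S)
    (hfix : ∀ b, (∀ g, ρ g b = b) → b = 0) (hz : ∃ a, ρ z a ≠ a) (c : V) :
    ∃ b, ρ z b - b = c := by
  let _ : Module ℤ[X] V := Module.compHom V (aeval (R := ℤ) (ρ z - 1)).toRingHom
  have smul_def : ∀ (p : ℤ[X]) (v : V), p • v = aeval (ρ z - 1) p v := fun _ _ => rfl
  have X_smul : ∀ v : V, (X : ℤ[X]) • v = ρ z v - v := fun v => by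
    rw [smul_def, aeval_X]; rfl
  let ρ' : G →* Module.End ℤ[X] V :=
    { toFun := fun g =>
        { toFun := ρ g
          map_add' := map_add _
          map_smul' := fun p v =>
            LinearMap.congr_fun
              (((hcomm g).sub_right (Commute.one_right _)).aeval_right p).eq v }
      map_one' := by ext; simp
      map_mul' := fun g h => by ext; simp }
  have hρ' : ∀ g v, ρ' g v = ρ g v := fun _ _ => rfl
  let C' : ℕ → Submodule ℤ[X] V := fun n =>
    { (C n).toAddSubmonoid with
      smul_mem' := fun p v hv => by
        have hX : ∀ k : ℕ, (X ^ k : ℤ[X]) • v ∈ C n := by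
          intro k
          induction k with
          | zero => simpa using hv
          | succ k ih =>
            rw [pow_succ', mul_smul, X_smul]
            exact hanti n.le_succ (hC n _ ih z)
        change p • v ∈ C n
        induction p using Polynomial.induction_on' with
        | add p q hp hq => rw [add_smul]; exact (C n).add_mem hp hq
        | monomial k c =>
          have : (monomial k c : ℤ[X]) • v = c • ((X ^ k : ℤ[X]) • v) := by
            rw [smul_def, smul_def, ← smul_X_eq_monomial, map_smul]; rfl
          rw [this]
          exact (C n).zsmul_mem (hX k) c }
  have hC'0 : C' 0 = ⊤ := by
    refine eq_top_iff.2 fun v _ => ?_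
    change v ∈ C 0
    rw [hC0]
    trivial
  obtain ⟨b, hb⟩ := smul_surjective_of_augSeries_le ρ' (w := (X : ℤ[X])) (z := z)
    (fun S hS hst => by
      obtain ⟨n, hn⟩ := hnil S.toAddSubgroup
        (fun h => hS (Submodule.toAddSubgroup_injective h)) hst
      refine ⟨n, ?_⟩
      rw [← hC'0]
      exact (augSeries_le C' hC n).trans hn)
    hfix X_smul (by
      obtain ⟨a, ha⟩ := hz
      exact ⟨a, by rw [X_smul]; exact sub_ne_zero.2 ha⟩) c
  exact ⟨b, by rw [← X_smul, hb]⟩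

end LinearReduction

section GroupTheory

open Subgroup
open scoped IsMulCommutative commutatorElement

/-- In a group in which each nontrivial normal subgroup contains a term of the lower central
series, a noncentral action of `z` on an abelian normal subgroup `A` satisfies `[z, A] = A`,
provided that `z` is central modulo `A` and the group has trivial centre. -/
theorem exists_commutator_eq_of_lowerCentralSeries_le {G : Type*} [Group G] [Group.FG G]
    (hnil : ∀ N : Subgroup G, N.Normal → N ≠ ⊥ → ∃ n, (⊤ : Subgroup G).lowerCentralSeries n ≤ N)
    (hcenter : center G = ⊥) (A : Subgroup G) [A.Normal] [IsMulCommutative A] {z : G}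
    (hzA : ∀ g, g⁻¹ * z⁻¹ * g * z ∈ A) (hz : ∃ a ∈ A, z * a ≠ a * z) {c : G} (hc : c ∈ A) :
    ∃ b ∈ A, z * b * z⁻¹ * b⁻¹ = c := by
  let ρ : G →* Module.End ℤ (Additive A) :=
    { toFun := fun g =>
        (MonoidHom.toAdditive (MulAut.conjNormal g : A ≃* A).toMonoidHom).toIntLinearMap
      map_one' := by ext; simp
      map_mul' := fun g h => by ext; simp }
  have hρ : ∀ g (a : Additive A), ((ρ g a).toMul : G) = g * (a.toMul : G) * g⁻¹ := fun _ _ => rfl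
  have hcoe : ∀ a b : Additive A, a = b ↔ (a.toMul : G) = (b.toMul : G) := fun a b =>
    ⟨fun h => by rw [h], fun h => Subtype.ext h⟩
  have hsub : ∀ a b : Additive A, ((a - b).toMul : G) = (a.toMul : G) * (b.toMul : G)⁻¹ :=
    fun a b => by rw [sub_eq_add_neg]; rfl
  suffices h : ∃ b, ρ z b - b = Additive.ofMul ⟨c, hc⟩ by
    obtain ⟨b, hb⟩ := h
    refine ⟨b.toMul, b.toMul.2, ?_⟩
    rw [hcoe, hsub, hρ] at hb
    exact hb
  refine sub_one_surjective_of_descending_series ρ (z := z) ?_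
    (fun n => (((⊤ : Subgroup G).lowerCentralSeries n).subgroupOf A).toAddSubgroup)
    ?_ ?_ ?_ ?_ ?_ ?_ _
  · intro g
    refine LinearMap.ext fun a => (hcoe _ _).2 ?_
    rw [Module.End.mul_apply, Module.End.mul_apply, hρ, hρ, hρ, hρ]
    have h := setLike_mul_comm (hzA g) a.toMul.2
    calc g * (z * (a.toMul : G) * z⁻¹) * g⁻¹
        = z * g * ((g⁻¹ * z⁻¹ * g * z) * (a.toMul : G)) * z⁻¹ * g⁻¹ := by group
      _ = z * g * ((a.toMul : G) * (g⁻¹ * z⁻¹ * g * z)) * z⁻¹ * g⁻¹ := by rw [h]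
      _ = z * (g * (a.toMul : G) * g⁻¹) * z⁻¹ := by group
  · exact eq_top_iff.2 fun a _ => mem_subgroupOf.2 (mem_top (a.toMul : G))
  · intro m n hmn a ha
    exact mem_subgroupOf.2 (Subgroup.lowerCentralSeries_antitone ⊤ hmn (mem_subgroupOf.1 ha))
  · intro n a ha g
    replace ha : (a.toMul : G) ∈ (⊤ : Subgroup G).lowerCentralSeries n := mem_subgroupOf.1 ha
    have h : ((ρ g a - a).toMul : G) = ⁅(a.toMul : G), g⁆⁻¹ := by
      rw [hsub, hρ, commutatorElement_def]
      group
    change ((ρ g a - a).toMul : G) ∈ (⊤ : Subgroup G).lowerCentralSeries (n + 1)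
    rw [h]
    exact inv_mem (commutator_mem_commutator ha (mem_top g))
  · intro S hS hst
    have hmem : ∀ a : Additive A,
        (a.toMul : G) ∈ (AddSubgroup.toSubgroup' S).map A.subtype → a ∈ S := by
      rintro a ⟨b, hb, hab⟩
      have h : b = a.toMul := Subtype.ext hab
      subst h
      exact hb
    obtain ⟨n, hn⟩ := hnil ((AddSubgroup.toSubgroup' S).map A.subtype) ⟨by
        rintro _ ⟨b, hb, rfl⟩ g
        exact ⟨_, hst g (Additive.ofMul b) hb, rfl⟩⟩
      (fun h => hS ((AddSubgroup.eq_bot_iff_forall _).2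
        fun s hs => (hcoe _ _).2 ((Subgroup.eq_bot_iff_forall _).1 h _ ⟨s.toMul, hs, rfl⟩)))
    exact ⟨n, fun a ha => hmem a (hn (mem_subgroupOf.1 ha))⟩
  · intro b hb
    have h : (b.toMul : G) ∈ center G := mem_center_iff.2 fun g => by
      have := (hcoe _ _).1 (hb g)
      rwa [hρ, mul_inv_eq_iff_eq_mul] at this
    rw [hcenter, mem_bot] at h
    exact (hcoe _ _).2 h
  · obtain ⟨a, ha, hza⟩ := hz
    refine ⟨Additive.ofMul ⟨a, ha⟩, fun h => hza ?_⟩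
    rw [hcoe, hρ] at h
    exact mul_inv_eq_iff_eq_mul.1 h

/-- A normal subgroup of a nilpotent group that meets the centre trivially is trivial. -/
theorem Subgroup.eq_bot_of_inf_center_eq_bot {G : Type*} [Group G] [Group.IsNilpotent G]
    (K : Subgroup G) [hK : K.Normal] (h : K ⊓ center G = ⊥) : K = ⊥ := by
  have key : ∀ n, ∀ k ∈ K, k ∈ upperCentralSeries G n → k = 1 := by
    intro n
    induction n with
    | zero => intro k _ hk; simpa using hk
    | succ n ih =>
      intro k hk hkn
      refine (Subgroup.eq_bot_iff_forall _).1 h k ⟨hk, mem_center_iff.2 fun g => ?_⟩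
      have h1 := ih (k * g * k⁻¹ * g⁻¹)
        (by simpa [mul_assoc] using mul_mem hk (hK.conj_mem _ (inv_mem hk) g))
        (mem_upperCentralSeries_succ_iff.1 hkn g)
      rw [mul_inv_eq_one, mul_inv_eq_iff_eq_mul] at h1
      exact h1.symm
  obtain ⟨n, hn⟩ := Group.IsNilpotent.nilpotent G
  exact (Subgroup.eq_bot_iff_forall _).2 fun k hk => key n k hk (hn ▸ mem_top k)

/-- A nontrivial soluble group has a nontrivial abelian normal subgroup. -/
theorem Group.IsSolvable.exists_normal_isMulCommutative (G : Type*) [Group G] [Nontrivial G]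
    [Group.IsSolvable G] : ∃ A : Subgroup G, A.Normal ∧ IsMulCommutative A ∧ A ≠ ⊥ := by
  classical
  have hex : ∃ n, derivedSeries G n = ⊥ := (Group.isSolvable_def G).1 ‹_›
  obtain ⟨n, hn, hmin⟩ : ∃ n, derivedSeries G n = ⊥ ∧ ∀ m < n, derivedSeries G m ≠ ⊥ :=
    ⟨Nat.find hex, Nat.find_spec hex, fun m hm => Nat.find_min hex hm⟩
  cases n with
  | zero => exact absurd hn (by simp)
  | succ n =>
    refine ⟨derivedSeries G n, derivedSeries_normal G n, .of_comm fun a b => ?_,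
      hmin n n.lt_succ_self⟩
    have h : ⁅(a : G), (b : G)⁆ ∈ derivedSeries G (n + 1) := commutator_mem_commutator a.2 b.2
    rw [hn, mem_bot, commutatorElement_eq_one_iff_mul_comm] at h
    exact Subtype.ext h

theorem Subgroup.map_mk'_lowerCentralSeries {G : Type*} [Group G] (N : Subgroup G) [N.Normal]
    (n : ℕ) : ((⊤ : Subgroup G).lowerCentralSeries n).map (QuotientGroup.mk' N) =
      (⊤ : Subgroup (G ⧸ N)).lowerCentralSeries n := by
  rw [Subgroup.map_lowerCentralSeries,
    Subgroup.map_top_of_surjective _ (QuotientGroup.mk'_surjective N)]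

theorem Subgroup.isNilpotent_quotient_iff {G : Type*} [Group G] {N : Subgroup G} [N.Normal] :
    Group.IsNilpotent (G ⧸ N) ↔ ∃ n, (⊤ : Subgroup G).lowerCentralSeries n ≤ N := by
  simp only [Subgroup.nilpotent_iff_lowerCentralSeries, ← map_mk'_lowerCentralSeries,
    Subgroup.map_eq_bot_iff, QuotientGroup.ker_mk']

/-- A maximal abelian normal subgroup with nilpotent quotient is its own centralizer. -/
theorem Subgroup.centralizer_le_of_maximal {G : Type*} [Group G] {A : Subgroup G}
    (hA : Maximal (fun B : Subgroup G => B.Normal ∧ IsMulCommutative B) A)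
    (hnil : ∃ n, (⊤ : Subgroup G).lowerCentralSeries n ≤ A) : centralizer (A : Set G) ≤ A := by
  have := hA.prop.1
  have := hA.prop.2
  have hGA : Group.IsNilpotent (G ⧸ A) := isNilpotent_quotient_iff.2 hnil
  have hmapn : ((centralizer (A : Set G)).map (QuotientGroup.mk' A)).Normal :=
    Normal.map inferInstance _ (QuotientGroup.mk'_surjective A)
  suffices h : (centralizer (A : Set G)).map (QuotientGroup.mk' A) = ⊥ by
    rwa [Subgroup.map_eq_bot_iff, QuotientGroup.ker_mk'] at h
  refine Subgroup.eq_bot_of_inf_center_eq_bot _ ((Subgroup.eq_bot_iff_forall _).2 ?_)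
  rintro _ ⟨⟨c, hc, rfl⟩, hcen⟩
  have hcen' : QuotientGroup.mk' A c ∈ center (G ⧸ A) := hcen
  have hzn : (zpowers (QuotientGroup.mk' A c)).Normal := ⟨by
    rintro _ ⟨k, rfl⟩ g
    refine ⟨k, ?_⟩
    have h := mem_center_iff.1 (zpow_mem hcen' k) g
    simp only
    rw [h, mul_inv_cancel_right]⟩
  set A' := (zpowers (QuotientGroup.mk' A c)).comap (QuotientGroup.mk' A) with hA'
  have hform : ∀ x ∈ A', ∃ k : ℤ, ∃ a ∈ A, x = c ^ k * a := by
    rintro x ⟨k, hk⟩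
    refine ⟨k, (c ^ k)⁻¹ * x, ?_, by group⟩
    rw [← QuotientGroup.eq]
    simpa using hk
  have hcomm : IsMulCommutative A' := .of_comm fun x y => by
    obtain ⟨i, a, ha, hx⟩ := hform x x.2
    obtain ⟨j, b, hb, hy⟩ := hform y y.2
    have hca : Commute c a := (mem_centralizer_iff.1 hc a ha).symm
    have hcb : Commute c b := (mem_centralizer_iff.1 hc b hb).symm
    have hab : Commute a b := setLike_mul_comm ha hb
    have h : Commute (c ^ i * a) (c ^ j * b) :=
      (((Commute.refl c).zpow_zpow i j).mul_right (hcb.zpow_left i)).mul_left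
        ((hca.symm.zpow_right j).mul_right hab)
    refine Subtype.ext ?_
    rw [Subgroup.coe_mul, Subgroup.coe_mul, hx, hy]
    exact h
  have hle : A ≤ A' := by
    intro a ha
    have : QuotientGroup.mk' A a = 1 := (QuotientGroup.eq_one_iff a).2 ha
    rw [hA', mem_comap, this]
    exact one_mem _
  have hcA : c ∈ A := hA.le_of_ge ⟨hzn.comap _, hcomm⟩ hle (mem_zpowers _)
  exact (QuotientGroup.eq_one_iff c).2 hcA

/-- In a finitely generated group each term of the lower central series is the normal closure of a
finite set. -/
theorem Group.FG.exists_finite_normalClosure_eq_lowerCentralSeries {G : Type*} [Group G]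
    [hG : Group.FG G] (n : ℕ) :
    ∃ F : Set G, F.Finite ∧ normalClosure F = (⊤ : Subgroup G).lowerCentralSeries n := by
  obtain ⟨X, hX, hXfin⟩ := Group.fg_iff.1 hG
  induction n with
  | zero => exact ⟨X, hXfin, top_le_iff.1 (hX ▸ closure_le_normalClosure)⟩
  | succ n ih =>
    obtain ⟨F, hF, hFn⟩ := ih
    refine ⟨Set.image2 (fun f x => ⁅f, x⁆) F X, hF.image2 _ hXfin, le_antisymm ?_ ?_⟩
    · refine normalClosure_le_normal ?_
      rintro _ ⟨f, hf, x, -, rfl⟩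
      exact commutator_mem_commutator (hFn ▸ subset_normalClosure hf) (mem_top x)
    · set N := normalClosure (Set.image2 (fun f x => ⁅f, x⁆) F X) with hN
      have hgen : ∀ f ∈ F, QuotientGroup.mk' N f ∈ center (G ⧸ N) := by
        intro f hf
        have htop : (centralizer {QuotientGroup.mk' N f}).comap (QuotientGroup.mk' N) = ⊤ := by
          rw [← top_le_iff, ← hX, closure_le]
          intro x hx
          rw [SetLike.mem_coe, mem_comap, mem_centralizer_singleton_iff,
            ← commutatorElement_eq_one_iff_mul_comm, ← commutatorElement_inv, inv_eq_one,
            ← map_commutatorElement]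
          exact (QuotientGroup.eq_one_iff _).2 (subset_normalClosure ⟨f, hf, x, hx, rfl⟩)
        refine mem_center_iff.2 fun y => ?_
        obtain ⟨g, rfl⟩ := QuotientGroup.mk'_surjective N y
        have hg : g ∈ (centralizer {QuotientGroup.mk' N f}).comap (QuotientGroup.mk' N) :=
          htop ▸ mem_top g
        exact mem_centralizer_singleton_iff.1 (mem_comap.1 hg)
      have hle : (⊤ : Subgroup G).lowerCentralSeries n ≤
          (center (G ⧸ N)).comap (QuotientGroup.mk' N) :=
        hFn ▸ normalClosure_le_normal hgen
      refine commutator_le.2 fun g hg h _ => (QuotientGroup.eq_one_iff _).1 ?_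
      change QuotientGroup.mk' N ⁅g, h⁆ = 1
      rw [map_commutatorElement, commutatorElement_eq_one_iff_mul_comm]
      exact (mem_center_iff.1 (hle hg) _).symm

/-- A finitely generated group that is not nilpotent has a normal subgroup that is maximal among
those with non-nilpotent quotient. -/
theorem Group.FG.exists_maximal_not_lowerCentralSeries_le {G : Type*} [Group G] [Group.FG G]
    (hG : ¬ Group.IsNilpotent G) : ∃ N : Subgroup G,
      Maximal (fun N => N.Normal ∧ ∀ n, ¬ (⊤ : Subgroup G).lowerCentralSeries n ≤ N) N := by
  have hbot : ∀ n, ¬ (⊤ : Subgroup G).lowerCentralSeries n ≤ ⊥ := fun n hn =>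
    hG (Subgroup.nilpotent_iff_lowerCentralSeries.2 ⟨n, le_bot_iff.1 hn⟩)
  suffices h : ∀ c ⊆ {N : Subgroup G | N.Normal ∧ ∀ n, ¬ (⊤ : Subgroup G).lowerCentralSeries n ≤ N},
      IsChain (· ≤ ·) c → ∀ M ∈ c,
        ∃ ub ∈ {N : Subgroup G | N.Normal ∧ ∀ n, ¬ (⊤ : Subgroup G).lowerCentralSeries n ≤ N},
          ∀ N ∈ c, N ≤ ub by
    obtain ⟨N, -, hN⟩ := zorn_le_nonempty₀ _ h ⊥ ⟨inferInstance, hbot⟩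
    exact ⟨N, hN⟩
  intro c hc hchain M hM
  have hmem : ∀ x, x ∈ sSup c ↔ ∃ N ∈ c, x ∈ N := fun x =>
    mem_sSup_of_directedOn ⟨M, hM⟩ hchain.directedOn
  refine ⟨sSup c, ⟨⟨fun x hx g => ?_⟩, fun n hn => ?_⟩, fun N hN => le_sSup hN⟩
  · obtain ⟨N, hN, hxN⟩ := (hmem x).1 hx
    exact (hmem _).2 ⟨N, hN, (hc hN).1.conj_mem x hxN g⟩
  · obtain ⟨F, hF, hFn⟩ := Group.FG.exists_finite_normalClosure_eq_lowerCentralSeries (G := G) n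
    have hsub : F ⊆ ⋃₀ ((fun N : Subgroup G => (N : Set G)) '' c) := by
      intro f hf
      obtain ⟨N, hN, hfN⟩ := (hmem f).1 (hn (hFn ▸ subset_normalClosure hf))
      exact ⟨N, ⟨N, hN, rfl⟩, hfN⟩
    have hdir : DirectedOn (· ⊆ ·) ((fun N : Subgroup G => (N : Set G)) '' c) := by
      rintro _ ⟨N, hN, rfl⟩ _ ⟨N', hN', rfl⟩
      obtain ⟨K, hK, h, h'⟩ := hchain.directedOn N hN N' hN'
      exact ⟨K, ⟨K, hK, rfl⟩, h, h'⟩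
    obtain ⟨_, ⟨N, hN, rfl⟩, hFN⟩ := hdir.exists_mem_subset_of_finite_of_subset_sUnion
      (Set.Nonempty.image _ ⟨M, hM⟩) hF hsub
    have := (hc hN).1
    exact (hc hN).2 n (hFn ▸ normalClosure_le_normal hFN)

/-- A finitely generated soluble group, each proper quotient of which is nilpotent, is nilpotent if
it is contranormal-free. -/
theorem Group.IsSolvable.isNilpotent_of_forall_quotient {G : Type*} [Group G] [Group.FG G]
    [Group.IsSolvable G]
    (hnil : ∀ N : Subgroup G, N.Normal → N ≠ ⊥ → ∃ n, (⊤ : Subgroup G).lowerCentralSeries n ≤ N)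
    (hcf : ∀ H : Subgroup G, normalClosure (H : Set G) = ⊤ → H = ⊤) : Group.IsNilpotent G := by
  by_contra hG
  have hcenter : center G = ⊥ := by
    by_contra h
    obtain ⟨n, hn⟩ := hnil (center G) inferInstance h
    exact hG (Subgroup.nilpotent_iff_lowerCentralSeries.2
      ⟨n + 1, Subgroup.lowerCentralSeries_succ_eq_bot _ hn⟩)
  have : Nontrivial G := by
    by_contra h
    rw [not_nontrivial_iff_subsingleton] at h
    exact hG inferInstance
  obtain ⟨A₀, hA₀n, hA₀c, hA₀⟩ := Group.IsSolvable.exists_normal_isMulCommutative G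
  obtain ⟨A, hA₀A, hA⟩ := zorn_le_nonempty₀
    {B : Subgroup G | B.Normal ∧ IsMulCommutative B} (fun c hc hchain M hM => by
      have hmem : ∀ x, x ∈ sSup c ↔ ∃ N ∈ c, x ∈ N := fun x =>
        mem_sSup_of_directedOn ⟨M, hM⟩ hchain.directedOn
      refine ⟨sSup c, ⟨⟨fun x hx g => ?_⟩, .of_comm fun x y => ?_⟩, fun N hN => le_sSup hN⟩
      · obtain ⟨N, hN, hxN⟩ := (hmem x).1 hx
        exact (hmem _).2 ⟨N, hN, (hc hN).1.conj_mem x hxN g⟩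
      · obtain ⟨N, hN, hxN⟩ := (hmem x).1 x.2
        obtain ⟨N', hN', hyN'⟩ := (hmem y).1 y.2
        obtain ⟨K, hK, h, h'⟩ := hchain.directedOn N hN N' hN'
        have := (hc hK).2
        exact Subtype.ext (setLike_mul_comm (h hxN) (h' hyN'))) A₀ ⟨hA₀n, hA₀c⟩
  have hAn : A.Normal := hA.prop.1
  have hAc : IsMulCommutative A := hA.prop.2
  have hAbot : A ≠ ⊥ := fun h => hA₀ (le_bot_iff.1 (h ▸ hA₀A))
  obtain ⟨n, hn⟩ := hnil A hAn hAbot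
  have hcen : centralizer (A : Set G) ≤ A := centralizer_le_of_maximal hA ⟨n, hn⟩
  have hAtop : A ≠ ⊤ := by
    intro h
    refine hAbot (le_bot_iff.1 (hcenter ▸ fun a ha => mem_center_iff.2 fun g => ?_))
    exact setLike_mul_comm (h ▸ mem_top g : g ∈ A) ha
  have : Nontrivial (G ⧸ A) := QuotientGroup.nontrivial_iff.2 hAtop
  have : Group.IsNilpotent (G ⧸ A) := isNilpotent_quotient_iff.2 ⟨n, hn⟩
  obtain ⟨y, hy, hy1⟩ := (center (G ⧸ A)).bot_or_exists_ne_one.resolve_left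
    (Group.IsNilpotent.center_ne_bot (G ⧸ A))
  obtain ⟨z, rfl⟩ := QuotientGroup.mk'_surjective A y
  have hz : z ∉ A := fun h => hy1 ((QuotientGroup.eq_one_iff z).2 h)
  have hzA : ∀ g, g⁻¹ * z⁻¹ * g * z ∈ A := by
    intro g
    have h := mem_center_iff.1 hy (QuotientGroup.mk' A g)
    rw [← QuotientGroup.eq_one_iff]
    change QuotientGroup.mk' A (g⁻¹ * z⁻¹ * g * z) = 1
    rw [map_mul, map_mul, map_mul, map_inv, map_inv, mul_assoc, h]
    group
  have hza : ∃ a ∈ A, z * a ≠ a * z := by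
    by_contra! h
    exact hz (hcen (mem_centralizer_iff.2 fun a ha => (h a ha).symm))
  have hsurj : ∀ c ∈ A, ∃ b ∈ A, z * b * z⁻¹ * b⁻¹ = c := fun c hc =>
    exists_commutator_eq_of_lowerCentralSeries_le hnil hcenter A hzA hza hc
  set N := normalClosure (centralizer {z} : Set G) with hN
  have hHN : centralizer {z} ≤ N := le_normalClosure
  have hzN : z ∈ N := hHN (mem_centralizer_singleton_iff.2 rfl)
  have hAN : A ≤ N := by
    intro c hc
    obtain ⟨b, -, rfl⟩ := hsurj c hc
    rw [mul_assoc, mul_assoc, ← mul_assoc b]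
    exact mul_mem hzN (normalClosure_normal.conj_mem _ (inv_mem hzN) b)
  have hNtop : N = ⊤ := by
    refine eq_top_iff.2 fun g _ => ?_
    have hc : z * g⁻¹ * z⁻¹ * g ∈ A := by
      have h := hAn.conj_mem _ (hzA g) z
      rwa [show z * (g⁻¹ * z⁻¹ * g * z) * z⁻¹ = z * g⁻¹ * z⁻¹ * g by group] at h
    obtain ⟨b, hb, hbc⟩ := hsurj _ hc
    have hgb : g * b ∈ centralizer {z} := by
      rw [mem_centralizer_singleton_iff]
      have h : b * z⁻¹ * b⁻¹ = g⁻¹ * z⁻¹ * g := by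
        simpa only [mul_assoc, mul_right_inj] using hbc
      have h' : b * z * b⁻¹ = g⁻¹ * z * g := by
        simpa [mul_assoc] using congrArg (·⁻¹) h
      rw [mul_inv_eq_iff_eq_mul] at h'
      rw [mul_assoc, h']
      group
    simpa using mul_mem (hHN hgb) (inv_mem (hAN hb))
  have hHtop := hcf _ hNtop
  obtain ⟨a, -, ha⟩ := hza
  exact ha (mem_centralizer_singleton_iff.1 (hHtop ▸ mem_top a)).symm

theorem Subgroup.isNilpotent_of_finite_of_contranormalFree {G : Type*} [Group G] [Finite G]
    (hcf : ∀ H : Subgroup G, normalClosure (H : Set G) = ⊤ → H = ⊤) : Group.IsNilpotent G := by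
  refine (Group.isNilpotent_of_finite_tfae.out 0 2).2 fun H hH => ?_
  rcases hH.le_iff.1 (le_normalClosure : H ≤ normalClosure (H : Set G)) with h | h
  · exact absurd (hcf H h) hH.1
  · exact h ▸ normalClosure_normal

theorem Subgroup.contranormalFree_quotient {G : Type*} [Group G]
    (hcf : ∀ H : Subgroup G, normalClosure (H : Set G) = ⊤ → H = ⊤) (N : Subgroup G) [N.Normal]
    (H : Subgroup (G ⧸ N)) (hH : normalClosure (H : Set (G ⧸ N)) = ⊤) : H = ⊤ := by
  have hsurj := QuotientGroup.mk'_surjective N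
  have hNH : N ≤ H.comap (QuotientGroup.mk' N) := by
    simpa using (QuotientGroup.mk' N).ker_le_comap H
  have h : H.comap (QuotientGroup.mk' N) = ⊤ := by
    refine hcf _ ?_
    have hmap := map_normalClosure (H.comap (QuotientGroup.mk' N) : Set G) _ hsurj
    rw [coe_comap, Set.image_preimage_eq _ hsurj, hH, ← map_top_of_surjective _ hsurj] at hmap
    have := congrArg (Subgroup.comap (QuotientGroup.mk' N)) hmap
    rwa [comap_map_eq, comap_map_eq, QuotientGroup.ker_mk', top_sup_eq, ← coe_comap,
      sup_eq_left.2 (hNH.trans le_normalClosure)] at this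
  rw [← map_comap_eq_self_of_surjective hsurj H, h, map_top_of_surjective _ hsurj]

end GroupTheory

/-- A finitely generated soluble-by-finite contranormal-free group is nilpotent. -/
theorem nilpotent_of_fg_solubleByFinite_contranormalFree {G : Type*} [Group G]
    (hfg : Group.FG G)
    (hsbf : ∃ H : Subgroup G, H.Normal ∧ IsSolvable H ∧ H.index ≠ 0)
    (hcf : ∀ H : Subgroup G, Subgroup.normalClosure (H : Set G) = ⊤ → H = ⊤) :
    Group.IsNilpotent G := by
  obtain ⟨S, hSn, hS, hSi⟩ := hsbf
  have hfin : Finite (G ⧸ S) := 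
    have : S.FiniteIndex := ⟨hSi⟩
    inferInstance
  have hGS : Group.IsNilpotent (G ⧸ S) := Subgroup.isNilpotent_of_finite_of_contranormalFree
    (Subgroup.contranormalFree_quotient hcf S)
  have hsol : Group.IsSolvable G :=
    (Group.isSolvable_iff_subgroup_quotient S).2 ⟨hS, inferInstance⟩
  by_contra hG
  obtain ⟨N, hN⟩ := Group.FG.exists_maximal_not_lowerCentralSeries_le hG
  have := hN.prop.1
  have hquot : Group.IsNilpotent (G ⧸ N) := by
    refine Group.IsSolvable.isNilpotent_of_forall_quotient (fun M hM hMbot => ?_)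
      (Subgroup.contranormalFree_quotient hcf N)
    have hNM : N ≤ M.comap (QuotientGroup.mk' N) := by
      simpa using (QuotientGroup.mk' N).ker_le_comap M
    by_contra! hcon
    have hMN := hN.le_of_ge ⟨hM.comap (QuotientGroup.mk' N), fun n hn => hcon n ?_⟩ hNM
    · refine hMbot ?_
      rw [← Subgroup.map_comap_eq_self_of_surjective (QuotientGroup.mk'_surjective N) M,
        Subgroup.map_eq_bot_iff, QuotientGroup.ker_mk']
      exact hMN
    · rw [← Subgroup.map_mk'_lowerCentralSeries]
      exact Subgroup.map_le_iff_le_comap.2 hn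
  obtain ⟨n, hn⟩ := Subgroup.isNilpotent_quotient_iff.1 hquot
  exact hN.prop.2 n hn
end
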